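/- For every real ℓ > 0 there exist a constant C > 0 and an integer N such that for all n ≥ N, the mean ℓ displacement of Hamiltonian paths on SG(n) with one end at o satisfies 2^{(n−1)ℓ}·( (2^{1+ℓ}+1)/(2^{2+ℓ}−1) − C·n·4^{−n} ) ≤ ξ(n,ℓ) ≤ 2^{nℓ}·( (2^{1+ℓ}+1)/(2^{2+ℓ}−1) + C·n·4^{−n} ). -/

import Mathlib

open scoped Classical
open Filter Topology

noncomputable section

namespace SierpinskiGasket

/-- √3 -/
def sq3 : ℝ := Real.sqrt 3

/-- the origin, leftmost outmost vertex of every `SG n` -/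
def o : ℝ × ℝ := (0, 0)

/-- `a m = (2^m, 0)`, the rightmost vertex of `SG m` (also a translation vector). -/
def a (m : ℕ) : ℝ × ℝ := ((2:ℝ) ^ m, 0)

/-- `b m = (2^(m-1), 2^(m-1)·√3)`, the topmost vertex of `SG m`. -/
def b (m : ℕ) : ℝ × ℝ := ((2:ℝ) ^ m / 2, (2:ℝ) ^ m / 2 * sq3)

/-- `c m = (3·2^(m-1), 2^(m-1)·√3)`. -/
def c (m : ℕ) : ℝ × ℝ := (3 * (2:ℝ) ^ m / 2, (2:ℝ) ^ m / 2 * sq3)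

/-- vertex set of `SG n` -/
def V : ℕ → Set (ℝ × ℝ)
  | 0 => {o, a 0, b 0}
  | n + 1 => V n ∪ ((· + a n) '' V n) ∪ ((· + b n) '' V n)

/-- edge set of `SG n` -/
def E : ℕ → Set (Sym2 (ℝ × ℝ))
  | 0 => {s(o, a 0), s(o, b 0), s(a 0, b 0)}
  | n + 1 => E n ∪ (Sym2.map (· + a n) '' E n) ∪ (Sym2.map (· + b n) '' E n)

/-- `SG n` as a simple graph on `ℝ × ℝ` -/
def G (n : ℕ) : SimpleGraph (ℝ × ℝ) := SimpleGraph.fromEdgeSet (E n)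

/-- a Hamiltonian path of `SG n`: a path visiting every vertex of `SG n` exactly once -/
def IsHamPath (n : ℕ) {u v : ℝ × ℝ} (p : (G n).Walk u v) : Prop :=
  p.IsPath ∧ ∀ x, x ∈ p.support ↔ x ∈ V n

/-- a Hamiltonian cycle of `SG n` -/
def IsHamCycle (n : ℕ) {u : ℝ × ℝ} (p : (G n).Walk u u) : Prop :=
  p.IsCycle ∧ ∀ x, x ∈ p.support ↔ x ∈ V n

/-- `f n u v`: the number of Hamiltonian paths of `SG n` with end-vertex set `{u, v}`
(for `u ≠ v`, such unordered paths correspond bijectively to walks from `u` to `v`). -/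
def f (n : ℕ) (u v : ℝ × ℝ) : ℕ := Nat.card {p : (G n).Walk u v // IsHamPath n p}

/-- `f1 n`: the number of Hamiltonian paths of `SG n` with end-vertex set `{o, a n}` -/
def f1 (n : ℕ) : ℕ := f n o (a n)

/-- the number of Hamiltonian cycles of `SG n`, counted up to starting vertex and
orientation: every Hamiltonian cycle passes through `o` and has exactly two
representatives as a closed walk based at `o`. -/
def HC (n : ℕ) : ℕ := Nat.card {p : (G n).Walk o o // IsHamCycle n p} / 2

/-- the number of Hamiltonian paths of `SG n` having `o` as one of their end vertices -/
def H0 (n : ℕ) : ℕ := ∑ᶠ x ∈ {x : ℝ × ℝ | x ≠ o}, f n o x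

/-- the total number of Hamiltonian paths of `SG n` (a path and its reversal
are the same unordered object, whence the division by `2`). -/
def H (n : ℕ) : ℕ := (∑ᶠ u : ℝ × ℝ, ∑ᶠ v : ℝ × ℝ, f n u v) / 2

/-- the distribution ratio `F(n,x) = f(n,x)/f1(n)` -/
def F (n : ℕ) (x : ℝ × ℝ) : ℝ := (f n o x : ℝ) / (f1 n : ℝ)

/-- `SG n` with the vertex `b n` (and its incident edges) deleted -/
def Gd (n : ℕ) : SimpleGraph (ℝ × ℝ) := SimpleGraph.fromEdgeSet {e ∈ E n | b n ∉ e}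

/-- Hamiltonian path of `SG n - b n` -/
def IsHamPathD (n : ℕ) {u v : ℝ × ℝ} (p : (Gd n).Walk u v) : Prop :=
  p.IsPath ∧ ∀ x, x ∈ p.support ↔ (x ∈ V n ∧ x ≠ b n)

/-- `g2 n x`: the number of Hamiltonian paths of `SG n - b n` with end-vertex set `{o, x}` -/
def g2 (n : ℕ) (x : ℝ × ℝ) : ℕ := Nat.card {p : (Gd n).Walk o x // IsHamPathD n p}

/-- `g1 n`: the number of Hamiltonian paths of `SG n - b n` with end-vertex set `{o, a n}` -/
def g1 (n : ℕ) : ℕ := g2 n (a n)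

/-- the distribution ratio `G₂(n,x) = g₂(n,x)/g₁(n)` -/
def G2 (n : ℕ) (x : ℝ × ℝ) : ℝ := (g2 n x : ℝ) / (g1 n : ℝ)

/-- mid-side vertex `a_{m,1} = (3·2^(m-1), 0)` -/
def a1 (m : ℕ) : ℝ × ℝ := (3 * (2:ℝ) ^ m / 2, 0)

/-- mid-side vertex `b_{m,1} = (5·2^(m-2), 2^(m-2)·√3)` -/
def b1 (m : ℕ) : ℝ × ℝ := (5 * (2:ℝ) ^ m / 4, (2:ℝ) ^ m / 4 * sq3)

/-- mid-side vertex `c_{m,1} = (7·2^(m-2), 2^(m-2)·√3)` -/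
def c1 (m : ℕ) : ℝ × ℝ := (7 * (2:ℝ) ^ m / 4, (2:ℝ) ^ m / 4 * sq3)

/-- mid-side vertex `a_{m,2} = (2^m, 2^(m-1)·√3)` -/
def a2 (m : ℕ) : ℝ × ℝ := ((2:ℝ) ^ m, (2:ℝ) ^ m / 2 * sq3)

/-- mid-side vertex `b_{m,2} = (3·2^(m-2), 3·2^(m-2)·√3)` -/
def b2 (m : ℕ) : ℝ × ℝ := (3 * (2:ℝ) ^ m / 4, 3 * (2:ℝ) ^ m / 4 * sq3)

/-- mid-side vertex `c_{m,2} = (5·2^(m-2), 3·2^(m-2)·√3)` -/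
def c2 (m : ℕ) : ℝ × ℝ := (5 * (2:ℝ) ^ m / 4, 3 * (2:ℝ) ^ m / 4 * sq3)

/-- exceptional vertex `a* = (2^(n-1), (2^(n-1)-1)·√3)` -/
def astar (n : ℕ) : ℝ × ℝ := ((2:ℝ) ^ n / 2, ((2:ℝ) ^ n / 2 - 1) * sq3)

/-- exceptional vertex `b* = (2^(n-1) - 1/2, (2^n-1)·√3/2)` -/
def bstar (n : ℕ) : ℝ × ℝ := ((2:ℝ) ^ n / 2 - 1/2, ((2:ℝ) ^ n - 1) * sq3 / 2)

/-- exceptional vertex `c* = (2^(n-1) + 1/2, (2^n-1)·√3/2)` -/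
def cstar (n : ℕ) : ℝ × ℝ := ((2:ℝ) ^ n / 2 + 1/2, ((2:ℝ) ^ n - 1) * sq3 / 2)

/-- the Euclidean norm on `ℝ × ℝ` -/
def enorm (x : ℝ × ℝ) : ℝ := Real.sqrt (x.1 ^ 2 + x.2 ^ 2)

/-- the set `C n` of corner vertices of `SG n` -/
def C (n : ℕ) : Finset (ℝ × ℝ) :=
  ((Finset.range (n + 1)).image a) ∪ ((Finset.range (n + 1)).image b) ∪
    ((Finset.range n).image c)

/-- the mean `ℓ` displacement over the corner vertices -/
def xi' (n : ℕ) (ℓ : ℝ) : ℝ :=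
  (∑ x ∈ C n, enorm x ^ ℓ * F n x) / (∑ x ∈ C n, F n x)

/-- `p(n,x)`: the probability that a Hamiltonian path with one end at `o`
has its other end at `x` -/
def p (n : ℕ) (x : ℝ × ℝ) : ℝ := (f n o x : ℝ) / (H0 n : ℝ)

/-- the mean `ℓ` displacement of Hamiltonian paths on `SG n` with one end at `o` -/
def xi (n : ℕ) (ℓ : ℝ) : ℝ :=
  ∑ᶠ x ∈ {x : ℝ × ℝ | x ∈ V n ∧ x ≠ o}, enorm x ^ ℓ * p n x

/-- the partition function of Hamiltonian paths on `SG n` -/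
def Z (n : ℕ) (β : ℝ) : ℝ := (H n : ℝ) * Real.exp (-(β * ((3 ^ (n + 1) + 1) / 2)))

section PathCount

variable {W : Type*} [DecidableEq W]

/-- The number of self-avoiding paths from `u` to `v` along the relation `r` whose set of
vertices is exactly `S`. -/
def pathCount (r : W → W → Prop) (S : Finset W) (u v : W) : ℕ :=
  if _h : u ∈ S then
    if u = v then (if S = {u} then 1 else 0)
    else ∑ w ∈ S.erase u, if r u w then pathCount r (S.erase u) w v else 0
  else 0
termination_by S.card
decreasing_by exact Finset.card_erase_lt_of_mem _h

variable {r r' : W → W → Prop} {S X Y : Finset W} {u v p q s : W}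

lemma pathCount_of_notMem_left (hu : u ∉ S) : pathCount r S u v = 0 := by
  rw [pathCount]; simp [hu]

lemma pathCount_step (hu : u ∈ S) (huv : u ≠ v) :
    pathCount r S u v =
      ∑ w ∈ S.erase u, if r u w then pathCount r (S.erase u) w v else 0 := by
  conv_lhs => rw [pathCount]
  simp [hu, huv]

lemma pathCount_singleton : pathCount r {u} u u = 1 := by
  rw [pathCount]; simp

lemma pathCount_self_eq_zero {x : W} (hx : x ∈ S) (hxu : x ≠ u) : pathCount r S u u = 0 := by
  rw [pathCount]
  have : S ≠ {u} := by rintro rfl; simp_all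
  simp [this]

lemma pathCount_of_notMem_right (hv : v ∉ S) : pathCount r S u v = 0 := by
  induction hn : S.card generalizing S u with
  | zero => 
    apply pathCount_of_notMem_left
    simp_all
  | succ n ih =>
    by_cases hu : u ∈ S
    · have huv : u ≠ v := by rintro rfl; exact hv hu
      rw [pathCount_step hu huv]
      apply Finset.sum_eq_zero
      intro w _
      rw [ih (S := S.erase u) (by simp [hv]) (by rw [Finset.card_erase_of_mem hu]; omega)]
      simp
    · exact pathCount_of_notMem_left hu

/-- Transport of path counts along a map that is injective on the vertex set. -/
lemma pathCount_image {W' : Type*} [DecidableEq W'] {r' : W' → W' → Prop} (φ : W → W')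
    (hinj : Set.InjOn φ S) (hr : ∀ x ∈ S, ∀ y ∈ S, (r' (φ x) (φ y) ↔ r x y))
    (hu : u ∈ S) (hv : v ∈ S) :
    pathCount r' (S.image φ) (φ u) (φ v) = pathCount r S u v := by
  induction hn : S.card generalizing S u with
  | zero => simp_all
  | succ n ih =>
    by_cases huv : u = v
    · subst huv
      by_cases hS : ∃ x ∈ S, x ≠ u
      · obtain ⟨x, hx, hxu⟩ := hS
        rw [pathCount_self_eq_zero hx hxu, pathCount_self_eq_zero (x := φ x)
          (Finset.mem_image_of_mem _ hx) (fun h => hxu (hinj hx hu h))]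
      · push Not at hS
        have : S = {u} := by ext x; simp only [Finset.mem_singleton]; grind
        subst this
        simp [pathCount_singleton]
    · have hφ : φ u ≠ φ v := fun h => huv (hinj hu hv h)
      have himg : (S.image φ).erase (φ u) = (S.erase u).image φ := by
        ext y
        simp only [Finset.mem_erase, Finset.mem_image]
        constructor
        · rintro ⟨h1, x, hx, rfl⟩
          exact ⟨x, ⟨fun h => h1 (by rw [h]), hx⟩, rfl⟩
        · rintro ⟨x, ⟨h1, hx⟩, rfl⟩
          exact ⟨fun h => h1 (hinj hx hu h), x, hx, rfl⟩
      rw [pathCount_step hu huv, pathCount_step (Finset.mem_image_of_mem _ hu) hφ, himg,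
        Finset.sum_image (fun x hx y hy h => hinj (Finset.mem_of_mem_erase hx)
          (Finset.mem_of_mem_erase hy) h)]
      refine Finset.sum_congr rfl fun w hw => ?_
      have hw' := Finset.mem_of_mem_erase hw
      simp only [hr u hu w hw']
      rw [ih (hinj.mono (by simp)) (fun x hx y hy => hr x (Finset.mem_of_mem_erase hx) y
        (Finset.mem_of_mem_erase hy)) hw (Finset.mem_erase.2 ⟨Ne.symm huv, hv⟩)
        (by rw [Finset.card_erase_of_mem hu]; omega)]

lemma pathCount_congr (hr : ∀ x ∈ S, ∀ y ∈ S, (r' x y ↔ r x y)) :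
    pathCount r' S u v = pathCount r S u v := by
  by_cases hu : u ∈ S
  · by_cases hv : v ∈ S
    · simpa using pathCount_image (r' := r') id (Function.injective_id.injOn) hr hu hv
    · rw [pathCount_of_notMem_right hv, pathCount_of_notMem_right hv]
  · rw [pathCount_of_notMem_left hu, pathCount_of_notMem_left hu]

/-- No path visits all of a vertex set with two parts not joined by edges. -/
lemma pathCount_eq_zero_of_disconnected (hS : ∀ w, w ∈ S ↔ w ∈ X ∨ w ∈ Y)
    (hXY : Disjoint X Y) (hX : X.Nonempty) (hr : ∀ y ∈ Y, ∀ x ∈ X, ¬ r y x) (hu : u ∈ Y) :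
    pathCount r S u v = 0 := by
  induction hn : Y.card generalizing S Y u with
  | zero => simp_all
  | succ n ih =>
    rw [Finset.disjoint_left] at hXY
    obtain ⟨x, hx⟩ := hX
    by_cases huv : u = v
    · subst huv
      exact pathCount_self_eq_zero (x := x) (by grind) (by grind)
    · rw [pathCount_step (by grind) huv]
      refine Finset.sum_eq_zero fun w hw => ?_
      split_ifs with hw'
      · refine ih (Y := Y.erase u) (by grind) (Finset.disjoint_left.2 (by grind)) (by grind)
          (by grind) ?_
        rw [Finset.card_erase_of_mem hu]; omega
      · rfl

/-- No path between two vertices of `Y` visits a part that hangs off `Y` at one vertex. -/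
lemma pathCount_eq_zero_of_pendant (hS : ∀ w, w ∈ S ↔ w ∈ X ∨ w ∈ Y)
    (hXY : ∀ w, w ∈ X ∧ w ∈ Y ↔ w = q)
    (hr : ∀ x ∈ X, ∀ y ∈ Y, x ≠ q → y ≠ q → ¬ r x y ∧ ¬ r y x)
    {x : W} (hx : x ∈ X) (hxq : x ≠ q) (hu : u ∈ Y) (hv : v ∈ Y) :
    pathCount r S u v = 0 := by
  induction hn : Y.card generalizing S Y u with
  | zero => simp_all
  | succ n ih =>
    by_cases huv : u = v
    · subst huv
      exact pathCount_self_eq_zero (x := x) (by grind) (by grind)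
    · rw [pathCount_step (by grind) huv]
      refine Finset.sum_eq_zero fun w hw => ?_
      split_ifs with hw'
      · by_cases huq : u = q
        · subst huq
          by_cases hwX : w ∈ X
          · exact pathCount_eq_zero_of_disconnected (X := Y.erase u) (Y := X.erase u) (by grind)
              (Finset.disjoint_left.2 (by grind)) ⟨v, by grind⟩ (by grind) (by grind)
          · exact pathCount_eq_zero_of_disconnected (X := X.erase u) (Y := Y.erase u) (by grind)
              (Finset.disjoint_left.2 (by grind)) ⟨x, by grind⟩ (by grind) (by grind)
        · refine ih (Y := Y.erase u) (by grind) (by grind) (by grind) (by grind) (by grind) ?_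
          rw [Finset.card_erase_of_mem hu]; omega
      · rfl

/-- Paths across a cut vertex. -/
lemma pathCount_cut (hS : ∀ w, w ∈ S ↔ w ∈ X ∨ w ∈ Y) (hXY : ∀ w, w ∈ X ∧ w ∈ Y ↔ w = q)
    (hr : ∀ x ∈ X, ∀ y ∈ Y, x ≠ q → y ≠ q → ¬ r x y ∧ ¬ r y x) (hu : u ∈ X) (hv : v ∈ Y) :
    pathCount r S u v = pathCount r X u q * pathCount r Y q v := by
  induction hn : X.card generalizing S X u with
  | zero => simp_all
  | succ n ih =>
    by_cases huq : u = q
    · subst huq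
      by_cases hX : ∃ x ∈ X, x ≠ u
      · obtain ⟨x, hx, hxq⟩ := hX
        rw [pathCount_self_eq_zero hx hxq, pathCount_eq_zero_of_pendant hS hXY hr hx hxq
          (by grind) hv, zero_mul]
      · have h1 : X = {u} := by grind
        have h2 : S = Y := by grind
        rw [h1, h2, pathCount_singleton, one_mul]
    · have huv : u ≠ v := by grind
      rw [pathCount_step (by grind) huv, pathCount_step hu huq, Finset.sum_mul]
      symm
      refine Finset.sum_subset_zero_on_sdiff (by grind) (by grind) fun w hw => ?_
      split_ifs with hw'
      · symm
        refine ih (X := X.erase u) (by grind) (by grind) (by grind) hw ?_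
        rw [Finset.card_erase_of_mem hu]; omega
      · simp

/-- Paths across a two-vertex cut, starting at a cut vertex. -/
lemma pathCount_two_cut_start (hS : ∀ w, w ∈ S ↔ w ∈ X ∨ w ∈ Y) (hpq : p ≠ q)
    (hXY : ∀ w, w ∈ X ∧ w ∈ Y ↔ w = p ∨ w = q)
    (hr : ∀ x ∈ X, ∀ y ∈ Y, x ∉ Y → y ∉ X → ¬ r x y ∧ ¬ r y x)
    (hr1 : ¬ r p q) (hv : v ∈ Y) :
    pathCount r S p v = pathCount r (X.erase q) p p * pathCount r Y p v +
      pathCount r X p q * pathCount r (Y.erase p) q v := by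
  have hpS : p ∈ S := by grind
  by_cases hX : ∃ x ∈ X, x ≠ p ∧ x ≠ q
  · obtain ⟨x, hx, hxp, hxq⟩ := hX
    rw [pathCount_self_eq_zero (x := x) (by grind) hxp, zero_mul, zero_add]
    by_cases hpv : p = v
    · subst hpv
      rw [pathCount_self_eq_zero (x := q) (by grind) (by grind),
        pathCount_of_notMem_right (S := Y.erase p) (by grind), mul_zero]
    · rw [pathCount_step hpS hpv, pathCount_step (S := X) (by grind) hpq, Finset.sum_mul]
      symm
      refine Finset.sum_subset_zero_on_sdiff (by grind) ?_ ?_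
      · intro w hw
        split_ifs with hw'
        · exact pathCount_eq_zero_of_pendant (X := X.erase p) (Y := Y.erase p) (q := q)
            (by grind) (by grind) (by grind) (x := x) (by grind) hxq (by grind) (by grind)
        · rfl
      · intro w hw
        split_ifs with hw'
        · symm
          exact pathCount_cut (X := X.erase p) (Y := Y.erase p) (q := q)
            (by grind) (by grind) (by grind) (by grind) (by grind)
        · simp
  · have h1 : X.erase q = {p} := by grind
    have h2 : S = Y := by grind
    have h3 : pathCount r X p q = 0 := by
      rw [pathCount_step (by grind) hpq]
      refine Finset.sum_eq_zero fun w hw => ?_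
      have : w = q := by grind
      subst this
      simp [hr1]
    rw [h1, h2, pathCount_singleton, h3]
    ring

/-- Paths across a two-vertex cut, between the two sides. -/
lemma pathCount_two_cut (hS : ∀ w, w ∈ S ↔ w ∈ X ∨ w ∈ Y) (hpq : p ≠ q)
    (hXY : ∀ w, w ∈ X ∧ w ∈ Y ↔ w = p ∨ w = q)
    (hr : ∀ x ∈ X, ∀ y ∈ Y, x ∉ Y → y ∉ X → ¬ r x y ∧ ¬ r y x)
    (hr1 : ¬ r p q) (hr2 : ¬ r q p) (hu : u ∈ X) (hv : v ∈ Y) :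
    pathCount r S u v =
      pathCount r X u p * pathCount r (Y.erase q) p v +
      pathCount r (X.erase q) u p * pathCount r Y p v +
      pathCount r X u q * pathCount r (Y.erase p) q v +
      pathCount r (X.erase p) u q * pathCount r Y q v := by
  induction hn : X.card generalizing S X u with
  | zero => simp_all
  | succ n ih =>
    by_cases hup : u = p
    · subst hup
      rw [pathCount_self_eq_zero (S := X) (x := q) (by grind) (by grind),
        pathCount_of_notMem_left (S := X.erase u) (by grind),
        pathCount_two_cut_start hS hpq hXY hr hr1 hv]
      ring
    by_cases huq : u = q
    · subst huq
      rw [pathCount_self_eq_zero (S := X) (x := p) (by grind) (by grind),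
        pathCount_of_notMem_left (S := X.erase u) (by grind),
        pathCount_two_cut_start hS (Ne.symm hpq) (fun w => by rw [hXY, or_comm]) hr hr2 hv]
      ring
    have huY : u ∉ Y := fun h => by grind
    have huv : u ≠ v := fun h => huY (h ▸ hv)
    have hsub : X.erase u ⊆ S.erase u := Finset.erase_subset_erase _ fun w hw => (hS w).2 (.inl hw)
    have hpX : p ∈ X := ((hXY p).2 (.inl rfl)).1
    have hqX : q ∈ X := ((hXY q).2 (.inr rfl)).1
    have ih' : ∀ w ∈ X.erase u, pathCount r (S.erase u) w v =
        pathCount r (X.erase u) w p * pathCount r (Y.erase q) p v +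
        pathCount r ((X.erase u).erase q) w p * pathCount r Y p v +
        pathCount r (X.erase u) w q * pathCount r (Y.erase p) q v +
        pathCount r ((X.erase u).erase p) w q * pathCount r Y q v := by
      intro w hw
      refine ih (S := S.erase u) (X := X.erase u) (by grind) (by grind) ?_ hw ?_
      · intro x hx y hy h1 h2
        exact hr x (Finset.mem_of_mem_erase hx) y hy h1 (by grind)
      · rw [Finset.card_erase_of_mem hu]; omega
    clear ih
    rw [pathCount_step (S := S) ((hS u).2 (.inl hu)) huv, pathCount_step (S := X) hu hup,
      pathCount_step (S := X) hu huq, pathCount_step (S := X.erase q) (by grind) hup,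
      pathCount_step (S := X.erase p) (by grind) huq]
    rw [Finset.erase_right_comm (a := q), Finset.erase_right_comm (a := p)]
    have hz : ∀ (g : W → ℕ) (z : W), g z = 0 →
        ∑ w ∈ (X.erase u).erase z, g w = ∑ w ∈ X.erase u, g w := fun g z h =>
      Finset.sum_erase _ h
    rw [hz _ q (by rw [pathCount_of_notMem_left (Finset.notMem_erase _ _)]; simp),
      hz _ p (by rw [pathCount_of_notMem_left (Finset.notMem_erase _ _)]; simp)]
    simp only [Finset.sum_mul, ← Finset.sum_add_distrib]
    symm
    refine Finset.sum_subset_zero_on_sdiff hsub ?_ fun w hw => ?_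
    · intro w hw
      have h1 : w ∈ Y := by grind
      have h2 : w ∉ X := by grind
      rw [if_neg (hr u hu w h1 huY h2).1]
    · rw [ih' w hw]
      split_ifs <;> simp

/-- Path counts of a two-edge path. -/
lemma pathCount_two_edges (hpq : p ≠ q) (hps : p ≠ s) (hqs : q ≠ s) (h1 : r p s) (h2 : r s q) :
    pathCount r {p, q, s} p q = 1 := by
  have e1 : ({p, q, s} : Finset W).erase p = {q, s} := by grind
  have e2 : ({q, s} : Finset W).erase s = {q} := by grind
  rw [pathCount_step (by simp) hpq, e1, Finset.sum_pair hqs,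
    pathCount_self_eq_zero (x := s) (by simp) (Ne.symm hqs),
    pathCount_step (S := {q, s}) (by simp) (Ne.symm hqs), e2, Finset.sum_singleton,
    pathCount_singleton]
  simp [h1, h2]

/-- Paths with both ends on one side of a two-vertex cut, starting at a cut vertex. -/
lemma pathCount_two_cut_same_start (hS : ∀ w, w ∈ S ↔ w ∈ X ∨ w ∈ Y) (hpq : p ≠ q)
    (hXY : ∀ w, w ∈ X ∧ w ∈ Y ↔ w = p ∨ w = q)
    (hr : ∀ x ∈ X, ∀ y ∈ Y, x ∉ Y → y ∉ X → ¬ r x y ∧ ¬ r y x)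
    {y : W} (hy : y ∈ Y) (hyX : y ∉ X) (hv : v ∈ X) :
    pathCount r S p v = pathCount r Y p q * pathCount r (X.erase p) q v := by
  have hpS : p ∈ S := by grind
  by_cases hpv : p = v
  · subst hpv
    rw [pathCount_self_eq_zero (x := q) (by grind) (by grind),
      pathCount_of_notMem_right (S := X.erase p) (by grind), mul_zero]
  · rw [pathCount_step hpS hpv, pathCount_step (S := Y) (by grind) hpq, Finset.sum_mul]
    symm
    refine Finset.sum_subset_zero_on_sdiff (by grind) ?_ ?_
    · intro w hw
      split_ifs with hw'
      · exact pathCount_eq_zero_of_pendant (X := Y.erase p) (Y := X.erase p) (q := q)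
          (by grind) (by grind) (by grind) (x := y) (by grind) (by grind) (by grind) (by grind)
      · rfl
    · intro w hw
      split_ifs with hw'
      · symm
        exact pathCount_cut (X := Y.erase p) (Y := X.erase p) (q := q)
          (by grind) (by grind) (by grind) (by grind) (by grind)
      · simp

/-- Series reduction: for paths with both ends in `X`, a part attached to `X` at `p` and `q` can
be replaced by a single vertex `s` adjacent to `p` and `q`. -/
lemma pathCount_series (hS : ∀ w, w ∈ S ↔ w ∈ X ∨ w ∈ Y) (hpq : p ≠ q)
    (hXY : ∀ w, w ∈ X ∧ w ∈ Y ↔ w = p ∨ w = q)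
    (hr : ∀ x ∈ X, ∀ y ∈ Y, x ∉ Y → y ∉ X → ¬ r x y ∧ ¬ r y x)
    {y : W} (hy : y ∈ Y) (hyX : y ∉ X) (hsX : s ∉ X)
    (hrX : ∀ x ∈ X, ∀ y ∈ X, (r' x y ↔ r x y))
    (hrs : ∀ x ∈ X, (r' x s ↔ x = p ∨ x = q) ∧ (r' s x ↔ x = p ∨ x = q))
    {m : ℕ} (h1 : pathCount r Y p q = m) (h2 : pathCount r Y q p = m) (hu : u ∈ X) (hv : v ∈ X) :
    pathCount r S u v = m * pathCount r' (insert s X) u v := by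
  induction hn : X.card generalizing S X u with
  | zero => simp_all
  | succ n ih =>
    have hpX : p ∈ X := ((hXY p).2 (.inl rfl)).1
    have hqX : q ∈ X := ((hXY q).2 (.inr rfl)).1
    have hps : p ≠ s := by grind
    have hqs : q ≠ s := by grind
    have hstar : ∀ p' q' : W, p' ≠ q' → (∀ w, w = p' ∨ w = q' ↔ w = p ∨ w = q) →
        pathCount r' (insert s X) p' v = pathCount r (X.erase p') q' v := by
      intro p' q' hpq' h
      have hp' : p' = p ∨ p' = q := (h p').1 (.inl rfl)
      have hq' : q' = p ∨ q' = q := (h q').1 (.inr rfl)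
      have hp'X : p' ∈ X := by grind
      have hq'X : q' ∈ X := by grind
      rw [pathCount_two_cut_same_start (X := X) (Y := {p', q', s}) (q := q') (y := s)
        (by grind) hpq' (by grind) ?_ (by grind) hsX hv,
        pathCount_two_edges hpq' (by grind) (by grind) (by grind) (by grind), one_mul]
      · exact pathCount_congr fun x hx y hy => hrX x (by grind) y (by grind)
      · intro x hx y hy h1 h2
        have : y = s := by grind
        subst this
        have := hrs x hx
        grind
    by_cases hup : u = p
    · subst hup
      rw [pathCount_two_cut_same_start hS hpq hXY hr hy hyX hv, h1,
        hstar u q hpq (fun w => Iff.rfl)]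
    by_cases huq : u = q
    · subst huq
      rw [pathCount_two_cut_same_start hS (Ne.symm hpq) (fun w => by rw [hXY, or_comm]) hr hy hyX hv,
        h2, hstar u p (Ne.symm hpq) (fun w => or_comm)]
    clear hstar
    by_cases huv : u = v
    · subst huv
      rw [pathCount_self_eq_zero (x := p) (by grind) (by grind),
        pathCount_self_eq_zero (x := p) (by grind) (by grind), mul_zero]
    have huY : u ∉ Y := fun h => by grind
    have hus : u ≠ s := by grind
    have hers : (insert s X).erase u = insert s (X.erase u) :=
      Finset.erase_insert_of_ne hus.symm
    rw [pathCount_step (by grind) huv, pathCount_step (S := insert s X) (by grind) huv, hers,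
      Finset.sum_insert (by simp [hsX]),
      if_neg (fun h => ((hrs u hu).1.1 h).elim hup huq), zero_add, Finset.mul_sum]
    symm
    refine Finset.sum_subset_zero_on_sdiff (by grind) ?_ fun w hw => ?_
    · intro w hw
      have h1 : w ∈ Y := by grind
      have h2 : w ∉ X := by grind
      rw [if_neg (hr u hu w h1 huY h2).1]
    · rw [hrX u hu w (Finset.mem_of_mem_erase hw)]
      split_ifs with hw'
      · symm
        refine ih (S := S.erase u) (X := X.erase u) (by grind) (by grind) ?_ (by grind) (by grind)
          ?_ ?_ hw (by grind) ?_
        · intro x hx y hy h1 h2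
          exact hr x (Finset.mem_of_mem_erase hx) y hy h1 (by grind)
        · intro x hx y hy
          exact hrX x (Finset.mem_of_mem_erase hx) y (Finset.mem_of_mem_erase hy)
        · intro x hx
          exact hrs x (Finset.mem_of_mem_erase hx)
        · rw [Finset.card_erase_of_mem hu]; omega
      · simp

/-- A list of vertices that forms a path is counted by `pathCount`. -/
lemma pathCount_pos_of_list (L : List W) (hL : L.IsChain r) (hnd : L.Nodup)
    (hne : L ≠ []) : 0 < pathCount r L.toFinset (L.head hne) (L.getLast hne) := by
  induction L with
  | nil => simp at hne
  | cons x L ih =>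
    rcases L with _ | ⟨y, L⟩
    · simp [pathCount_singleton]
    · have ih' := ih hL.tail (List.nodup_cons.1 hnd).2 (by simp)
      have hx : x ∉ (y :: L).toFinset := by simpa using (List.nodup_cons.1 hnd).1
      have hlast : (x :: y :: L).getLast hne = (y :: L).getLast (by simp) := by simp
      have hxl : x ≠ (y :: L).getLast (by simp) := fun h =>
        hx (by rw [List.mem_toFinset]; exact h ▸ List.getLast_mem _)
      have hers : (x :: y :: L).toFinset.erase x = (y :: L).toFinset := by
        rw [List.toFinset_cons, Finset.erase_insert hx]
      rw [hlast, List.head_cons, pathCount_step (by simp) hxl, hers]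
      have hr : r x y := by
        have := hL
        simp only [List.isChain_cons_cons] at this
        exact this.1
      refine lt_of_lt_of_le ih' ?_
      refine le_trans ?_ (Finset.single_le_sum (f := fun w => if r x w then
        pathCount r (y :: L).toFinset w ((y :: L).getLast (by simp)) else 0)
        (fun _ _ => Nat.zero_le _) (a := y) (by simp))
      simp [hr]

end PathCount

section Triangle

variable {W : Type*} [DecidableEq W] {r r' : W → W → Prop} {S A B T X Y : Finset W}
  {a b c a' b' s t u v p q w : W}

/-- The relation `r` in which the neighbours of `s` are replaced by `q` and `w`. -/
def attach (r : W → W → Prop) (s q w x y : W) : Prop :=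
  if x = s then y = q ∨ y = w else if y = s then x = q ∨ x = w else r x y

lemma attach_of_ne (hu : u ≠ s) (hv : v ≠ s) : attach r s q w u v ↔ r u v := by
  simp [attach, hu, hv]

lemma attach_left : attach r s q w s v ↔ v = q ∨ v = w := by simp [attach]

lemma attach_right (hu : u ≠ s) : attach r s q w u s ↔ u = q ∨ u = w := by simp [attach, hu]

/-- Three parts arranged in a triangle, consecutive parts sharing exactly one vertex. -/
structure Triangle (r : W → W → Prop) (A B T : Finset W) (a b c : W) : Prop where
  memAB : ∀ w, w ∈ A ∧ w ∈ B ↔ w = a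
  memAT : ∀ w, w ∈ A ∧ w ∈ T ↔ w = b
  memBT : ∀ w, w ∈ B ∧ w ∈ T ↔ w = c
  hab : a ≠ b
  hac : a ≠ c
  hbc : b ≠ c
  rAB : ∀ x ∈ A, ∀ y ∈ B, x ≠ a → y ≠ a → ¬ r x y ∧ ¬ r y x
  rAT : ∀ x ∈ A, ∀ y ∈ T, x ≠ b → y ≠ b → ¬ r x y ∧ ¬ r y x
  rBT : ∀ x ∈ B, ∀ y ∈ T, x ≠ c → y ≠ c → ¬ r x y ∧ ¬ r y x

namespace Triangle

omit [DecidableEq W] in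
lemma swap (h : Triangle r A B T a b c) : Triangle r A T B b a c where
  memAB := h.memAT
  memAT := h.memAB
  memBT w := by rw [and_comm, h.memBT]
  hab := h.hab.symm
  hac := h.hbc
  hbc := h.hac
  rAB := h.rAT
  rAT := h.rAB
  rBT x hx y hy h1 h2 := (h.rBT y hy x hx h2 h1).symm

lemma eraseB (h : Triangle r A B T a b c) (hta : t ≠ a) (htc : t ≠ c) :
    Triangle r A (B.erase t) T a b c where
  memAB w := by
    have := h.memAB w
    simp only [Finset.mem_erase]
    constructor
    · rintro ⟨h1, _, h2⟩; exact this.1 ⟨h1, h2⟩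
    · rintro rfl; exact ⟨(this.2 rfl).1, hta.symm, (this.2 rfl).2⟩
  memAT := h.memAT
  memBT w := by
    have := h.memBT w
    simp only [Finset.mem_erase]
    constructor
    · rintro ⟨⟨_, h1⟩, h2⟩; exact this.1 ⟨h1, h2⟩
    · rintro rfl; exact ⟨⟨htc.symm, (this.2 rfl).1⟩, (this.2 rfl).2⟩
  hab := h.hab
  hac := h.hac
  hbc := h.hbc
  rAB x hx y hy := h.rAB x hx y (Finset.mem_of_mem_erase hy)
  rAT := h.rAT
  rBT x hx := h.rBT x (Finset.mem_of_mem_erase hx)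

lemma eraseT (h : Triangle r A B T a b c) (htb : t ≠ b) (htc : t ≠ c) :
    Triangle r A B (T.erase t) a b c := (h.swap.eraseB htb htc).swap

section mem

omit [DecidableEq W]

variable (h : Triangle r A B T a b c)
include h

lemma aA : a ∈ A := ((h.memAB a).2 rfl).1
lemma aB : a ∈ B := ((h.memAB a).2 rfl).2
lemma bA : b ∈ A := ((h.memAT b).2 rfl).1
lemma bT : b ∈ T := ((h.memAT b).2 rfl).2
lemma cB : c ∈ B := ((h.memBT c).2 rfl).1
lemma cT : c ∈ T := ((h.memBT c).2 rfl).2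
lemma aT : a ∉ T := fun h' => h.hab ((h.memAT a).1 ⟨h.aA, h'⟩)
lemma bB : b ∉ B := fun h' => h.hab.symm ((h.memAB b).1 ⟨h.bA, h'⟩)
lemma cA : c ∉ A := fun h' => h.hac.symm ((h.memAB c).1 ⟨h', h.cB⟩)
end mem

lemma mem_inter_union (h : Triangle r A B T a b c) (w : W) :
    w ∈ A ∧ w ∈ B ∪ T ↔ w = a ∨ w = b := by
  rw [Finset.mem_union, and_or_left, h.memAB, h.memAT]

lemma not_rel_union (h : Triangle r A B T a b c) :
    ∀ x ∈ A, ∀ y ∈ B ∪ T, x ∉ B ∪ T → y ∉ A → ¬ r x y ∧ ¬ r y x := by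
  intro x hx y hy h1 h2
  rw [Finset.mem_union, not_or] at h1
  rcases Finset.mem_union.1 hy with hy | hy
  · exact h.rAB x hx y hy (fun e => h1.1 (e ▸ h.aB)) (fun e => h2 (e ▸ h.aA))
  · exact h.rAT x hx y hy (fun e => h1.2 (e ▸ h.bT)) (fun e => h2 (e ▸ h.bA))

lemma not_rel_ab (h : Triangle r A B T a b c) : ¬ r a b ∧ ¬ r b a :=
  h.rBT a h.aB b h.bT h.hac h.hbc

/-- Paths through two parts glued at `c`. -/
lemma cut (h : Triangle r A B T a b c) (hu : u ∈ T) (hv : v ∈ B) :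
    pathCount r (B ∪ T) u v = pathCount r T u c * pathCount r B c v :=
  pathCount_cut (X := T) (Y := B) (fun w => by rw [Finset.mem_union, or_comm])
    (fun w => by rw [and_comm, h.memBT])
    (fun x hx y hy h1 h2 => (h.rBT y hy x hx h2 h1).symm) hu hv

lemma pendant (h : Triangle r A B T a b c) (ht : t ∈ T) (htc : t ≠ c) (hu : u ∈ B) (hv : v ∈ B) :
    pathCount r (B ∪ T) u v = 0 :=
  pathCount_eq_zero_of_pendant (X := T) (Y := B) (q := c)
    (fun w => by rw [Finset.mem_union, or_comm])
    (fun w => by rw [and_comm, h.memBT])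
    (fun x hx y hy h1 h2 => (h.rBT y hy x hx h2 h1).symm) ht htc hu hv

/-- Paths from the first part of a triangle to another part. -/
lemma count_side (h : Triangle r A B T a b c) (hS : ∀ w, w ∈ S ↔ w ∈ A ∨ w ∈ B ∨ w ∈ T)
    (ht : t ∈ T) (htb : t ≠ b) (htc : t ≠ c) (hu : u ∈ A) (hv : v ∈ B) :
    pathCount r S u v = pathCount r T b c * (pathCount r A u b * pathCount r (B.erase a) c v +
      pathCount r (A.erase a) u b * pathCount r B c v) := by
  have e1 : (B ∪ T).erase b = B ∪ T.erase b := by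
    rw [Finset.erase_union_distrib, Finset.erase_eq_of_notMem h.bB]
  have e2 : (B ∪ T).erase a = B.erase a ∪ T := by
    rw [Finset.erase_union_distrib, Finset.erase_eq_of_notMem h.aT]
  have hcut2 : pathCount r (B.erase a ∪ T) b v = pathCount r T b c * pathCount r (B.erase a) c v := by
    by_cases hva : v = a
    · subst hva
      rw [pathCount_of_notMem_right (by simp [h.aT]),
        pathCount_of_notMem_right (S := B.erase v) (by simp), mul_zero]
    · refine pathCount_cut (X := T) (Y := B.erase a) ?_ ?_ ?_ h.bT (Finset.mem_erase.2 ⟨hva, hv⟩)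
      · intro w; rw [Finset.mem_union, or_comm]
      · intro w
        have := h.memBT w
        constructor
        · rintro ⟨h1, h2⟩; exact this.1 ⟨Finset.mem_of_mem_erase h2, h1⟩
        · rintro rfl; exact ⟨h.cT, Finset.mem_erase.2 ⟨h.hac.symm, h.cB⟩⟩
      · exact fun x hx y hy h1 h2 => (h.rBT y (Finset.mem_of_mem_erase hy) x hx h2 h1).symm
  have hpend : pathCount r (B ∪ T.erase b) a v = 0 := by
    refine pathCount_eq_zero_of_pendant (X := T.erase b) (Y := B) (q := c) ?_ ?_ ?_
      (x := t) (Finset.mem_erase.2 ⟨htb, ht⟩) htc h.aB hv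
    · intro w; rw [Finset.mem_union, or_comm]
    · intro w
      have := h.memBT w
      constructor
      · rintro ⟨h1, h2⟩; exact this.1 ⟨h2, Finset.mem_of_mem_erase h1⟩
      · rintro rfl; exact ⟨Finset.mem_erase.2 ⟨h.hbc.symm, h.cT⟩, h.cB⟩
    · exact fun x hx y hy h1 h2 => (h.rBT y hy x (Finset.mem_of_mem_erase hx) h2 h1).symm
  rw [pathCount_two_cut (X := A) (Y := B ∪ T) (p := a) (q := b)
    (fun w => by rw [hS, Finset.mem_union]) h.hab h.mem_inter_union h.not_rel_union
    h.not_rel_ab.1 h.not_rel_ab.2 hu (Finset.mem_union_left _ hv), e1, e2, hpend, hcut2,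
    h.pendant ht htc h.aB hv, h.cut h.bT hv]
  ring

/-- Paths with both ends in the first part of a triangle. -/
lemma count_base (h : Triangle r A B T a b c) (hS : ∀ w, w ∈ S ↔ w ∈ A ∨ w ∈ B ∨ w ∈ T)
    (hs : s ∉ A) {m : ℕ} (h1 : pathCount r T b c * pathCount r B c a = m)
    (h2 : pathCount r B a c * pathCount r T c b = m) (hu : u ∈ A) (hv : v ∈ A) :
    pathCount r S u v = m * pathCount (attach r s a b) (insert s A) u v := by
  refine pathCount_series (X := A) (Y := B ∪ T) (p := a) (q := b)
    (fun w => by rw [hS, Finset.mem_union]) h.hab h.mem_inter_union h.not_rel_union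
    (Finset.mem_union_left _ h.cB) h.cA hs ?_ ?_ ?_ ?_ hu hv
  · intro x hx y hy
    exact attach_of_ne (fun e => hs (e ▸ hx)) (fun e => hs (e ▸ hy))
  · intro x hx
    exact ⟨attach_right (fun e => hs (e ▸ hx)), attach_left⟩
  · rw [← h2, Finset.union_comm]
    exact h.swap.cut h.aB h.bT |>.trans (by ring)
  · rw [h.cut h.bT h.aB, h1]

end Triangle
end Triangle

section Bridge

variable {W : Type*} [DecidableEq W] {r r' : W → W → Prop} {S A B T X Y : Finset W}
  {a b c a' b' s t u v p q w : W}

/-- Two parts sharing the vertex `c`, joined by a further vertex `s` adjacent to `a'` in the first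
and to `b'` in the second part. -/
structure Bridge (r : W → W → Prop) (B T : Finset W) (s c a' b' : W) : Prop where
  memBT : ∀ w, w ∈ B ∧ w ∈ T ↔ w = c
  rBT : ∀ x ∈ B, ∀ y ∈ T, x ≠ c → y ≠ c → ¬ r x y ∧ ¬ r y x
  ha' : a' ∈ B
  hb' : b' ∈ T
  a'_ne : a' ≠ c
  b'_ne : b' ≠ c
  hsB : s ∉ B
  hsT : s ∉ T
  rsB : ∀ x ∈ B, (r x s ↔ x = a' ∨ x = b') ∧ (r s x ↔ x = a' ∨ x = b')
  rsT : ∀ x ∈ T, (r x s ↔ x = a' ∨ x = b') ∧ (r s x ↔ x = a' ∨ x = b')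
  rca : ¬ r c a' ∧ ¬ r a' c

namespace Bridge

section mem

omit [DecidableEq W]

variable (h : Bridge r B T s c a' b')
include h

lemma a'T : a' ∉ T := fun h' => h.a'_ne ((h.memBT a').1 ⟨h.ha', h'⟩)
lemma b'B : b' ∉ B := fun h' => h.b'_ne ((h.memBT b').1 ⟨h', h.hb'⟩)
lemma cB : c ∈ B := ((h.memBT c).2 rfl).1
lemma cT : c ∈ T := ((h.memBT c).2 rfl).2
lemma sa' : a' ≠ s := fun e => h.hsB (e ▸ h.ha')
lemma sb' : b' ≠ s := fun e => h.hsT (e ▸ h.hb')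
lemma corners_ne : a' ≠ b' := fun e => h.a'T (e ▸ h.hb')
end mem

lemma eraseB (h : Bridge r B T s c a' b') (ht : t ≠ c) (hta : t ≠ a') :
    Bridge r (B.erase t) T s c a' b' where
  memBT w := by
    have := h.memBT w
    simp only [Finset.mem_erase]
    constructor
    · rintro ⟨⟨_, h1⟩, h2⟩; exact this.1 ⟨h1, h2⟩
    · rintro rfl; exact ⟨⟨ht.symm, (this.2 rfl).1⟩, (this.2 rfl).2⟩
  rBT x hx := h.rBT x (Finset.mem_of_mem_erase hx)
  ha' := Finset.mem_erase.2 ⟨hta.symm, h.ha'⟩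
  hb' := h.hb'
  a'_ne := h.a'_ne
  b'_ne := h.b'_ne
  hsB h' := h.hsB (Finset.mem_of_mem_erase h')
  hsT := h.hsT
  rsB x hx := h.rsB x (Finset.mem_of_mem_erase hx)
  rsT := h.rsT
  rca := h.rca

lemma eraseT (h : Bridge r B T s c a' b') (ht : t ≠ c) (htb : t ≠ b') :
    Bridge r B (T.erase t) s c a' b' where
  memBT w := by
    have := h.memBT w
    simp only [Finset.mem_erase]
    constructor
    · rintro ⟨h1, _, h2⟩; exact this.1 ⟨h1, h2⟩
    · rintro rfl; exact ⟨(this.2 rfl).1, ht.symm, (this.2 rfl).2⟩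
  rBT x hx y hy := h.rBT x hx y (Finset.mem_of_mem_erase hy)
  ha' := h.ha'
  hb' := Finset.mem_erase.2 ⟨htb.symm, h.hb'⟩
  a'_ne := h.a'_ne
  b'_ne := h.b'_ne
  hsB := h.hsB
  hsT h' := h.hsT (Finset.mem_of_mem_erase h')
  rsB := h.rsB
  rsT x hx := h.rsT x (Finset.mem_of_mem_erase hx)
  rca := h.rca

section chain
variable (h : Bridge r B T s c a' b') {T' : Finset W} (hT : T' ⊆ T) (hb : b' ∈ T')
include h hT hb

omit hb in
lemma chain_rel : ∀ x ∈ T', ∀ y ∈ ({b', a', s} : Finset W), x ≠ b' → y ≠ b' → x ≠ c →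
    ¬ r x y ∧ ¬ r y x := by
  intro x hx y hy h1 h2 hc
  simp only [Finset.mem_insert, Finset.mem_singleton] at hy
  rcases hy with rfl | rfl | rfl
  · exact absurd rfl h2
  · exact (h.rBT _ h.ha' x (hT hx) h.a'_ne hc).symm
  · have := h.rsT x (hT hx)
    have hxa : x ≠ a' := fun e => h.a'T (e ▸ hT hx)
    exact ⟨fun e => (this.1.1 e).elim hxa h1, fun e => (this.2.1 e).elim hxa h1⟩

lemma chain_mem (w : W) : w ∈ T' ∧ w ∈ ({b', a', s} : Finset W) ↔ w = b' := by
  simp only [Finset.mem_insert, Finset.mem_singleton]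
  constructor
  · rintro ⟨h1, rfl | rfl | rfl⟩
    · rfl
    · exact absurd (hT h1) h.a'T
    · exact absurd (hT h1) h.hsT
  · rintro rfl; exact ⟨hb, .inl rfl⟩

lemma chain_rel' : ∀ x ∈ T', ∀ y ∈ ({b', a', s} : Finset W), x ≠ b' → y ≠ b' →
    ¬ r x y ∧ ¬ r y x := by
  intro x hx y hy h1 h2
  by_cases hc : x = c
  · subst hc
    simp only [Finset.mem_insert, Finset.mem_singleton] at hy
    rcases hy with rfl | rfl | rfl
    · exact absurd rfl h2
    · exact h.rca
    · have := h.rsT x (hT hx)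
      exact ⟨fun e => (this.1.1 e).elim h.a'_ne.symm h1,
        fun e => (this.2.1 e).elim h.a'_ne.symm h1⟩
  · exact h.chain_rel hT x hx y hy h1 h2 hc

lemma count_chain (hu : u ∈ T') :
    pathCount r (insert s (insert a' T')) u a' = pathCount r T' u b' := by
  rw [pathCount_cut (X := T') (Y := {b', a', s}) (q := b') ?_ (h.chain_mem hT hb)
    (h.chain_rel' hT hb) hu (by simp),
    pathCount_two_edges h.corners_ne.symm h.sb' h.sa' ((h.rsT b' h.hb').1.2 (.inr rfl))
      ((h.rsB a' h.ha').2.2 (.inl rfl)), mul_one]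
  intro w
  simp only [Finset.mem_insert, Finset.mem_singleton]
  constructor
  · rintro (h1 | h1 | h1) <;> simp [h1]
  · rintro (h1 | rfl | h1 | h1)
    · simp [h1]
    · simp [hb]
    · simp [h1]
    · simp [h1]

lemma count_chain_reverse (hu : u ∈ T') :
    pathCount r (insert s (insert a' T')) a' u = pathCount r T' b' u := by
  have e : ({b', a', s} : Finset W) = {a', b', s} := Finset.insert_comm _ _ _
  rw [pathCount_cut (X := {b', a', s}) (Y := T') (q := b') ?_
    (fun w => by rw [and_comm, h.chain_mem hT hb])
    (fun x hx y hy h1 h2 => (h.chain_rel' hT hb y hy x hx h2 h1).symm) (by simp) hu, e,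
    pathCount_two_edges h.corners_ne h.sa' h.sb' ((h.rsB a' h.ha').1.2 (.inl rfl))
      ((h.rsT b' h.hb').2.2 (.inr rfl)), one_mul]
  intro w
  simp only [Finset.mem_insert, Finset.mem_singleton]
  constructor
  · rintro (h1 | h1 | h1) <;> simp [h1]
  · rintro ((rfl | h1 | h1) | h1)
    · simp [hb]
    · simp [h1]
    · simp [h1]
    · simp [h1]

lemma count_pendant (hu : u ∈ T') (hv : v ∈ T') :
    pathCount r (insert s T') u v = 0 := by
  refine pathCount_eq_zero_of_pendant (X := {b', s}) (Y := T') (q := b') ?_ ?_ ?_ (x := s)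
    (by simp) h.sb'.symm hu hv
  · intro w
    simp only [Finset.mem_insert, Finset.mem_singleton]
    constructor
    · rintro (h1 | h1) <;> simp [h1]
    · rintro ((rfl | h1) | h1)
      · simp [hb]
      · simp [h1]
      · simp [h1]
  · intro w
    rw [← h.chain_mem hT hb w]
    simp only [Finset.mem_insert, Finset.mem_singleton]
    constructor
    · rintro ⟨h1 | h1, h2⟩ <;> exact ⟨h2, by simp [h1]⟩
    · rintro ⟨h2, h1 | rfl | h1⟩
      · exact ⟨.inl h1, h2⟩
      · exact absurd (hT h2) h.a'T
      · exact ⟨.inr h1, h2⟩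
  · intro x hx y hy h1 h2
    refine (h.chain_rel' hT hb y hy x ?_ h2 h1).symm
    simp only [Finset.mem_insert, Finset.mem_singleton] at hx ⊢
    tauto

lemma count_pendant' (hu : u ∈ T') (hv : v ∈ T') :
    pathCount r (insert s (insert a' T')) u v = 0 := by
  refine pathCount_eq_zero_of_pendant (X := {b', a', s}) (Y := T') (q := b') ?_
    (fun w => by rw [and_comm, h.chain_mem hT hb])
    (fun x hx y hy h1 h2 => (h.chain_rel' hT hb y hy x hx h2 h1).symm) (x := s)
    (by simp) h.sb'.symm hu hv
  intro w
  simp only [Finset.mem_insert, Finset.mem_singleton]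
  constructor
  · rintro (h1 | h1 | h1) <;> simp [h1]
  · rintro ((rfl | h1 | h1) | h1)
    · simp [hb]
    · simp [h1]
    · simp [h1]
    · simp [h1]

end chain

lemma mem_union_iff (h : Bridge r B T s c a' b') (w : W) :
    w ∈ insert s (B ∪ T) ↔ w ∈ B ∨ w ∈ insert s (insert a' T) := by
  have := h.ha'
  simp only [Finset.mem_insert, Finset.mem_union]
  constructor
  · rintro (h1 | h1 | h1) <;> simp [h1]
  · rintro (h1 | h1 | rfl | h1)
    · simp [h1]
    · simp [h1]
    · simp [this]
    · simp [h1]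

lemma mem_inter_iff (h : Bridge r B T s c a' b') (w : W) :
    w ∈ B ∧ w ∈ insert s (insert a' T) ↔ w = c ∨ w = a' := by
  rw [← h.memBT]
  simp only [Finset.mem_insert]
  constructor
  · rintro ⟨h1, rfl | h2 | h2⟩
    · exact absurd h1 h.hsB
    · simp [h2]
    · simp [h1, h2]
  · rintro (⟨h1, h2⟩ | rfl)
    · simp [h1, h2]
    · simp [h.ha']

lemma not_rel (h : Bridge r B T s c a' b') : ∀ x ∈ B, ∀ y ∈ insert s (insert a' T),
    x ∉ insert s (insert a' T) → y ∉ B → ¬ r x y ∧ ¬ r y x := by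
  intro x hx y hy h1 h2
  simp only [Finset.mem_insert, not_or] at hy h1
  rcases hy with rfl | rfl | hy
  · have := h.rsB x hx
    have hb : x ≠ b' := fun e => h.b'B (e ▸ hx)
    exact ⟨fun e => (this.1.1 e).elim h1.2.1 hb, fun e => (this.2.1 e).elim h1.2.1 hb⟩
  · exact absurd h.ha' h2
  · exact h.rBT x hx y hy (fun e => h1.2.2 (e ▸ h.cT)) (fun e => h2 (e ▸ h.cB))

/-- Paths from the second to the first part of a bridge. -/
lemma count_across (h : Bridge r B T s c a' b') (hu : u ∈ T) (huc : u ≠ c) (hv : v ∈ B) :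
    pathCount r (insert s (B ∪ T)) u v =
      pathCount r T u b' * pathCount r (B.erase c) a' v +
      pathCount r (T.erase c) u b' * pathCount r B a' v := by
  have e1 : (insert s (insert a' T)).erase a' = insert s T := by
    rw [Finset.erase_insert_of_ne h.sa'.symm, Finset.erase_insert h.a'T]
  have hsc : s ≠ c := fun e => h.hsB (e ▸ h.cB)
  have e2 : (insert s (insert a' T)).erase c = insert s (insert a' (T.erase c)) := by
    rw [Finset.erase_insert_of_ne hsc, Finset.erase_insert_of_ne h.a'_ne]
  have hu' : u ∈ T.erase c := Finset.mem_erase.2 ⟨huc, hu⟩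
  have hb' : b' ∈ T.erase c := Finset.mem_erase.2 ⟨h.b'_ne, h.hb'⟩
  rw [pathCount_two_cut (X := insert s (insert a' T)) (Y := B) (p := c) (q := a')
    (fun w => by rw [h.mem_union_iff, or_comm]) h.a'_ne.symm
    (fun w => by rw [and_comm, h.mem_inter_iff])
    (fun x hx y hy h1 h2 => (h.not_rel y hy x hx h2 h1).symm) h.rca.1 h.rca.2 (by simp [hu]) hv,
    e1, e2, h.count_chain (Finset.Subset.refl _) h.hb' hu,
    h.count_chain (Finset.erase_subset _ _) hb' hu',
    h.count_pendant (Finset.Subset.refl _) h.hb' hu h.cT,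
    h.count_pendant' (Finset.Subset.refl _) h.hb' hu h.cT]
  ring

/-- Paths with both ends in the first part of a bridge. -/
lemma count_same (h : Bridge r B T s c a' b') {m : ℕ} (h1 : pathCount r T c b' = m)
    (h2 : pathCount r T b' c = m) (hu : u ∈ B) (hv : v ∈ B) :
    pathCount r (insert s (B ∪ T)) u v = m * pathCount (attach r s c a') (insert s B) u v := by
  refine pathCount_series h.mem_union_iff h.a'_ne.symm h.mem_inter_iff h.not_rel
    (y := s) (by simp) h.hsB h.hsB ?_ ?_ ?_ ?_ hu hv
  · intro x hx y hy
    exact attach_of_ne (fun e => h.hsB (e ▸ hx)) (fun e => h.hsB (e ▸ hy))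
  · intro x hx
    exact ⟨attach_right (fun e => h.hsB (e ▸ hx)), attach_left⟩
  · rw [h.count_chain (Finset.Subset.refl _) h.hb' h.cT, h1]
  · rw [h.count_chain_reverse (Finset.Subset.refl _) h.hb' h.cT, h2]

end Bridge

end Bridge

section BridgedTriangle

variable {W : Type*} [DecidableEq W] {r r' : W → W → Prop} {S A B T X Y : Finset W}
  {a b c a' b' s t u v p q w : W}

/-- A triangle whose second and third part are moreover joined by a vertex `s`. -/
structure BridgedTriangle (r : W → W → Prop) (A B T : Finset W) (a b c s a' b' : W) : Prop where
  tri : Triangle r A B T a b c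
  br : Bridge r B T s c a' b'
  br' : Bridge r T B s c b' a'
  hsA : s ∉ A
  rsA : ∀ x ∈ A, ¬ r x s ∧ ¬ r s x
  haa' : a ≠ a'
  hbb' : b ≠ b'

namespace BridgedTriangle

lemma swap (h : BridgedTriangle r A B T a b c s a' b') :
    BridgedTriangle r A T B b a c s b' a' :=
  ⟨h.tri.swap, h.br', h.br, h.hsA, h.rsA, h.hbb', h.haa'⟩

lemma mem_inter_iff (h : BridgedTriangle r A B T a b c s a' b') (w : W) :
    w ∈ A ∧ w ∈ insert s (B ∪ T) ↔ w = a ∨ w = b := by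
  rw [← h.tri.mem_inter_union, Finset.mem_insert]
  constructor
  · rintro ⟨h1, rfl | h2⟩
    · exact absurd h1 h.hsA
    · exact ⟨h1, h2⟩
  · rintro ⟨h1, h2⟩; exact ⟨h1, .inr h2⟩

lemma not_rel (h : BridgedTriangle r A B T a b c s a' b') :
    ∀ x ∈ A, ∀ y ∈ insert s (B ∪ T), x ∉ insert s (B ∪ T) → y ∉ A → ¬ r x y ∧ ¬ r y x := by
  intro x hx y hy h1 h2
  rcases Finset.mem_insert.1 hy with rfl | hy
  · exact h.rsA x hx
  · exact h.tri.not_rel_union x hx y hy (fun e => h1 (Finset.mem_insert_of_mem e)) h2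

/-- Paths with both ends in the first part of a bridged triangle. -/
lemma count_base (h : BridgedTriangle r A B T a b c s a' b')
    (hS : ∀ w, w ∈ S ↔ w ∈ A ∨ w ∈ insert s (B ∪ T)) {m : ℕ}
    (h1 : pathCount r B a a' * pathCount r (T.erase c) b' b +
      pathCount r (B.erase c) a a' * pathCount r T b' b = m)
    (h2 : pathCount r T b b' * pathCount r (B.erase c) a' a +
      pathCount r (T.erase c) b b' * pathCount r B a' a = m) (hu : u ∈ A) (hv : v ∈ A) :
    pathCount r S u v = m * pathCount (attach r s a b) (insert s A) u v := by
  refine pathCount_series hS h.tri.hab h.mem_inter_iff h.not_rel (y := s) (by simp) h.hsA h.hsA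
    ?_ ?_ ?_ ?_ hu hv
  · intro x hx y hy
    exact attach_of_ne (fun e => h.hsA (e ▸ hx)) (fun e => h.hsA (e ▸ hy))
  · intro x hx
    exact ⟨attach_right (fun e => h.hsA (e ▸ hx)), attach_left⟩
  · rw [Finset.union_comm, h.br'.count_across h.tri.aB h.tri.hac h.tri.bT, h1]
  · rw [h.br.count_across h.tri.bT h.tri.hbc h.tri.aB, h2]

/-- Paths from the first part of a bridged triangle to another part. -/
lemma count_side (h : BridgedTriangle r A B T a b c s a' b')
    (hS : ∀ w, w ∈ S ↔ w ∈ A ∨ w ∈ insert s (B ∪ T)) {m₁ m₂ : ℕ}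
    (h1 : pathCount r (T.erase b) c b' = m₁) (h1' : pathCount r (T.erase b) b' c = m₁)
    (h2 : pathCount r T c b' = m₂) (h2' : pathCount r T b' c = m₂) (hu : u ∈ A) (hv : v ∈ B) :
    pathCount r S u v =
      (pathCount r A u a * m₁ + pathCount r (A.erase b) u a * m₂) *
        pathCount (attach r s c a') (insert s B) a v +
      pathCount r A u b * (pathCount r T b b' * pathCount r ((B.erase a).erase c) a' v +
        pathCount r (T.erase c) b b' * pathCount r (B.erase a) a' v) +
      pathCount r (A.erase a) u b * (pathCount r T b b' * pathCount r (B.erase c) a' v +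
        pathCount r (T.erase c) b b' * pathCount r B a' v) := by
  have hsa : s ≠ a := fun e => h.hsA (e ▸ h.tri.aA)
  have hsb : s ≠ b := fun e => h.hsA (e ▸ h.tri.bA)
  have e1 : (insert s (B ∪ T)).erase b = insert s (B ∪ T.erase b) := by
    rw [Finset.erase_insert_of_ne hsb, Finset.erase_union_distrib,
      Finset.erase_eq_of_notMem h.tri.bB]
  have e2 : (insert s (B ∪ T)).erase a = insert s (B.erase a ∪ T) := by
    rw [Finset.erase_insert_of_ne hsa, Finset.erase_union_distrib,
      Finset.erase_eq_of_notMem h.tri.aT]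
  have e3 : pathCount r (insert s (B.erase a ∪ T)) b v =
      pathCount r T b b' * pathCount r ((B.erase a).erase c) a' v +
        pathCount r (T.erase c) b b' * pathCount r (B.erase a) a' v := by
    by_cases hva : v = a
    · subst hva
      rw [pathCount_of_notMem_right (by simp [h.tri.aT, hsa.symm]),
        pathCount_of_notMem_right (S := (B.erase v).erase c) (by simp),
        pathCount_of_notMem_right (S := B.erase v) (by simp)]
      ring
    · exact (h.br.eraseB h.tri.hac h.haa').count_across h.tri.bT h.tri.hbc
        (Finset.mem_erase.2 ⟨hva, hv⟩)
  rw [pathCount_two_cut (X := A) (Y := insert s (B ∪ T)) (p := a) (q := b) hS h.tri.hab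
    h.mem_inter_iff h.not_rel h.tri.not_rel_ab.1 h.tri.not_rel_ab.2 hu (by simp [hv]), e1, e2, e3,
    (h.br.eraseT h.tri.hbc h.hbb').count_same h1 h1' h.tri.aB hv,
    h.br.count_same h2 h2' h.tri.aB hv, h.br.count_across h.tri.bT h.tri.hbc hv]
  ring

end BridgedTriangle

end BridgedTriangle

section Lattice

/-- The right corner of the level-`n` gasket in lattice coordinates. -/
def cornerA (n : ℕ) : ℤ × ℤ := (2 ^ n, 0)

/-- The top corner of the level-`n` gasket in lattice coordinates. -/
def cornerB (n : ℕ) : ℤ × ℤ := (0, 2 ^ n)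

/-- The vertices of the level-`n` gasket in lattice coordinates. -/
def verts : ℕ → Finset (ℤ × ℤ)
  | 0 => {(0, 0), (1, 0), (0, 1)}
  | n + 1 => verts n ∪ (verts n).image (· + cornerA n) ∪ (verts n).image (· + cornerB n)

/-- Adjacency in the level-`n` gasket in lattice coordinates. -/
def latAdj : ℕ → ℤ × ℤ → ℤ × ℤ → Prop
  | 0, u, v => u ∈ verts 0 ∧ v ∈ verts 0 ∧ u ≠ v
  | n + 1, u, v => latAdj n u v ∨ latAdj n (u - cornerA n) (v - cornerA n) ∨
      latAdj n (u - cornerB n) (v - cornerB n)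

/-- The rotation of the level-`n` gasket mapping `0` to `cornerA n` and `cornerA n` to
`cornerB n`. -/
def rotate (n : ℕ) (x : ℤ × ℤ) : ℤ × ℤ := (2 ^ n - x.1 - x.2, x.1)

variable {n : ℕ} {x u v d : ℤ × ℤ}

lemma mem_image_add : x ∈ (verts n).image (· + d) ↔ x - d ∈ verts n := by
  simp only [Finset.mem_image]
  constructor
  · rintro ⟨y, hy, rfl⟩; simpa using hy
  · intro h; exact ⟨_, h, by simp⟩

lemma mem_verts_succ : x ∈ verts (n + 1) ↔
    x ∈ verts n ∨ x - cornerA n ∈ verts n ∨ x - cornerB n ∈ verts n := by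
  rw [verts, Finset.mem_union, Finset.mem_union, mem_image_add, mem_image_add, or_assoc]

lemma mem_verts_zero : x ∈ verts 0 ↔ x = (0, 0) ∨ x = (1, 0) ∨ x = (0, 1) := by
  simp [verts]

lemma verts_bounds (hx : x ∈ verts n) : 0 ≤ x.1 ∧ 0 ≤ x.2 ∧ x.1 + x.2 ≤ 2 ^ n := by
  induction n generalizing x with
  | zero => rcases mem_verts_zero.1 hx with rfl | rfl | rfl <;> simp
  | succ n ih =>
    have hN : (0 : ℤ) < 2 ^ n := by positivity
    rw [pow_succ]
    rcases mem_verts_succ.1 hx with h | h | h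
    · have := ih h
      refine ⟨?_, ?_, ?_⟩ <;> linarith
    all_goals
      have := ih h
      simp only [cornerA, cornerB, Prod.fst_sub, Prod.snd_sub] at this
      refine ⟨?_, ?_, ?_⟩ <;> linarith

lemma zero_mem_verts : (0 : ℤ × ℤ) ∈ verts n := by
  induction n with
  | zero => exact mem_verts_zero.2 (.inl rfl)
  | succ n ih => exact mem_verts_succ.2 (.inl ih)

lemma corner_mem_verts : cornerA n ∈ verts n ∧ cornerB n ∈ verts n := by
  induction n with
  | zero => simp [verts, cornerA, cornerB]
  | succ n ih =>
    have h1 : cornerA (n + 1) - cornerA n = cornerA n := by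
      ext <;> simp [cornerA, pow_succ]; ring
    have h2 : cornerB (n + 1) - cornerB n = cornerB n := by
      ext <;> simp [cornerB, pow_succ]; ring
    exact ⟨mem_verts_succ.2 (.inr (.inl (by rw [h1]; exact ih.1))),
      mem_verts_succ.2 (.inr (.inr (by rw [h2]; exact ih.2)))⟩

lemma one_mem_verts : ((1, 0) : ℤ × ℤ) ∈ verts n := by
  induction n with
  | zero => simp [verts]
  | succ n ih => exact mem_verts_succ.2 (.inl ih)

lemma latAdj_mem (h : latAdj n u v) : u ∈ verts n ∧ v ∈ verts n ∧ u ≠ v := by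
  induction n generalizing u v with
  | zero => exact h
  | succ n ih =>
    rcases h with h | h | h <;> have := ih h <;>
      exact ⟨mem_verts_succ.2 (by tauto), mem_verts_succ.2 (by tauto),
        fun e => this.2.2 (by rw [e])⟩

lemma latAdj_symm (h : latAdj n u v) : latAdj n v u := by
  induction n generalizing u v with
  | zero => exact ⟨h.2.1, h.1, h.2.2.symm⟩
  | succ n ih =>
    rcases h with h | h | h
    · exact .inl (ih h)
    · exact .inr (.inl (ih h))
    · exact .inr (.inr (ih h))

lemma latAdj_near (h : latAdj n u v) : |u.1 - v.1| ≤ 1 ∧ |u.2 - v.2| ≤ 1 := by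
  induction n generalizing u v with
  | zero =>
    obtain ⟨h1, h2, -⟩ := h
    rcases mem_verts_zero.1 h1 with rfl | rfl | rfl <;>
      rcases mem_verts_zero.1 h2 with rfl | rfl | rfl <;> simp
  | succ n ih =>
    rcases h with h | h | h
    · exact ih h
    · simpa using ih h
    · simpa using ih h

lemma two_le_pow (hn : 1 ≤ n) : (2 : ℤ) ≤ 2 ^ n := by
  calc (2 : ℤ) = 2 ^ 1 := by norm_num
    _ ≤ 2 ^ n := pow_le_pow_right₀ (by norm_num) hn

lemma not_latAdj_of_far (hn : 1 ≤ n) (h : u.1 - v.1 = 2 ^ n ∨ u.2 - v.2 = 2 ^ n) :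
    ¬ latAdj n u v ∧ ¬ latAdj n v u := by
  have h2 := two_le_pow hn
  have : ¬ latAdj n u v := by
    intro hadj
    have := latAdj_near hadj
    rw [abs_le, abs_le] at this
    rcases h with h | h <;> linarith
  exact ⟨this, fun h' => this (latAdj_symm h')⟩

lemma swap_mem_verts : x.swap ∈ verts n ↔ x ∈ verts n := by
  induction n generalizing x with
  | zero =>
    obtain ⟨i, j⟩ := x
    simp only [mem_verts_zero, Prod.swap_prod_mk, Prod.mk.injEq]
    tauto
  | succ n ih =>
    have h1 : x.swap - cornerA n = (x - cornerB n).swap := by ext <;> simp [cornerA, cornerB]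
    have h2 : x.swap - cornerB n = (x - cornerA n).swap := by ext <;> simp [cornerA, cornerB]
    rw [mem_verts_succ, mem_verts_succ, h1, h2, ih, ih, ih]
    tauto

lemma swap_latAdj : latAdj n u.swap v.swap ↔ latAdj n u v := by
  induction n generalizing u v with
  | zero => simp only [latAdj, swap_mem_verts, ne_eq, Prod.swap_inj]
  | succ n ih =>
    have h1 (x : ℤ × ℤ) : x.swap - cornerA n = (x - cornerB n).swap := by
      ext <;> simp [cornerA, cornerB]
    have h2 (x : ℤ × ℤ) : x.swap - cornerB n = (x - cornerA n).swap := by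
      ext <;> simp [cornerA, cornerB]
    rw [latAdj, latAdj, h1, h1, h2, h2, ih, ih, ih]
    tauto

lemma rotate_succ : rotate (n + 1) x = rotate n (x - cornerB n) ∧
    rotate (n + 1) x - cornerA n = rotate n x ∧
    rotate (n + 1) x - cornerB n = rotate n (x - cornerA n) := by
  refine ⟨?_, ?_, ?_⟩ <;> ext <;> simp [rotate, cornerA, cornerB, pow_succ] <;> ring

lemma rotate_injective : Function.Injective (rotate n) := by
  intro x y h
  simp only [rotate, Prod.mk.injEq] at h
  ext <;> linarith [h.1, h.2]

lemma rotate_mem_verts : rotate n x ∈ verts n ↔ x ∈ verts n := by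
  induction n generalizing x with
  | zero =>
    obtain ⟨i, j⟩ := x
    simp only [mem_verts_zero, rotate, Prod.mk.injEq]
    omega
  | succ n ih =>
    rw [mem_verts_succ, mem_verts_succ, rotate_succ.2.1, rotate_succ.2.2, rotate_succ.1, ih, ih, ih]
    tauto

lemma rotate_latAdj : latAdj n (rotate n u) (rotate n v) ↔ latAdj n u v := by
  induction n generalizing u v with
  | zero => simp only [latAdj, rotate_mem_verts, ne_eq, rotate_injective.eq_iff]
  | succ n ih =>
    rw [latAdj, latAdj, rotate_succ.2.1, rotate_succ.2.2, rotate_succ.1, rotate_succ.2.1,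
      rotate_succ.2.2, rotate_succ.1, ih, ih, ih]
    tauto

lemma exists_rotate_eq (y : ℤ × ℤ) : ∃ x, rotate n x = y :=
  ⟨(y.2, 2 ^ n - y.1 - y.2), by ext <;> simp [rotate]⟩

/-- A vertex outside every `verts n`. -/
def outer : ℤ × ℤ := (-1, -1)

lemma outer_notMem_verts : outer ∉ verts n := fun h => by
  have := (verts_bounds h).1
  simp [outer] at this

end Lattice

section Cell

variable {W : Type*} [DecidableEq W] {r r' : W → W → Prop} {X D : Finset W}
  {n : ℕ} {p q w s t : W} {φ : ℤ × ℤ → W} {u v : ℤ × ℤ}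

/-- Number of Hamiltonian paths joining two corners. -/
def cornerPaths (n : ℕ) : ℕ := pathCount (latAdj n) (verts n) 0 (cornerA n)

/-- Number of paths joining two corners and visiting everything but the third corner. -/
def cornerPathsDel (n : ℕ) : ℕ :=
  pathCount (latAdj n) ((verts n).erase (cornerB n)) 0 (cornerA n)

/-- Number of Hamiltonian paths starting in a given corner. -/
def sumF (n : ℕ) : ℕ := ∑ x ∈ verts n, pathCount (latAdj n) (verts n) 0 x

/-- As `sumF`, with one of the other corners removed. -/
def sumG (n : ℕ) : ℕ := ∑ x ∈ verts n, pathCount (latAdj n) ((verts n).erase (cornerA n)) 0 x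

/-- As `sumF`, with both other corners removed. -/
def sumR (n : ℕ) : ℕ :=
  ∑ x ∈ verts n, pathCount (latAdj n) (((verts n).erase (cornerA n)).erase (cornerB n)) 0 x

/-- Number of Hamiltonian paths from `0` to `x` once `cornerA n` and `cornerB n` are joined by
an additional vertex. -/
def bypass (n : ℕ) (x : ℤ × ℤ) : ℕ :=
  pathCount (attach (latAdj n) outer (cornerA n) (cornerB n)) (insert outer (verts n)) 0 x

/-- As `sumF`, for paths counted by `bypass`. -/
def sumT (n : ℕ) : ℕ := ∑ x ∈ verts n, bypass n x

/-- `φ` identifies the level-`n` gasket with the vertices `X` of the relation `r`. -/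
structure CellMap (n : ℕ) (r : W → W → Prop) (X : Finset W) (φ : ℤ × ℤ → W) : Prop where
  inj : Set.InjOn φ (verts n)
  img : X = (verts n).image φ
  rel : ∀ x ∈ verts n, ∀ y ∈ verts n, (r (φ x) (φ y) ↔ latAdj n x y)

/-- `X` is a copy of the level-`n` gasket with corners `p`, `q`, `w`. -/
def Cell (n : ℕ) (r : W → W → Prop) (X : Finset W) (p q w : W) : Prop :=
  ∃ φ, CellMap n r X φ ∧ φ 0 = p ∧ φ (cornerA n) = q ∧ φ (cornerB n) = w

namespace CellMap

variable (h : CellMap n r X φ)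
include h

lemma image_erase {D : Finset (ℤ × ℤ)} (hD : D ⊆ verts n) (hu : u ∈ verts n) :
    (D.image φ).erase (φ u) = (D.erase u).image φ := by
  ext y
  simp only [Finset.mem_erase, Finset.mem_image]
  constructor
  · rintro ⟨h1, x, hx, rfl⟩
    exact ⟨x, ⟨fun e => h1 (e ▸ rfl), hx⟩, rfl⟩
  · rintro ⟨x, ⟨h1, hx⟩, rfl⟩
    exact ⟨fun e => h1 (h.inj (hD hx) hu e), x, hx, rfl⟩

lemma count {D : Finset (ℤ × ℤ)} (hD : D ⊆ verts n) (hu : u ∈ verts n) (hv : v ∈ verts n) :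
    pathCount r (D.image φ) (φ u) (φ v) = pathCount (latAdj n) D u v := by
  have key : ∀ z ∈ verts n, z ∉ D → φ z ∉ D.image φ := by
    intro z hz hzD hmem
    obtain ⟨y, hy, e⟩ := Finset.mem_image.1 hmem
    exact hzD (h.inj (hD hy) hz e ▸ hy)
  by_cases hu' : u ∈ D
  · by_cases hv' : v ∈ D
    · exact pathCount_image φ (h.inj.mono hD) (fun x hx y hy => h.rel x (hD hx) y (hD hy)) hu' hv'
    · rw [pathCount_of_notMem_right hv', pathCount_of_notMem_right (key v hv hv')]
  · rw [pathCount_of_notMem_left hu', pathCount_of_notMem_left (key u hu hu')]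

lemma sum {D : Finset (ℤ × ℤ)} (hD : D ⊆ verts n) (hu : u ∈ verts n) :
    ∑ x ∈ X, pathCount r (D.image φ) (φ u) x = ∑ x ∈ verts n, pathCount (latAdj n) D u x := by
  rw [h.img, Finset.sum_image h.inj]
  exact Finset.sum_congr rfl fun x hx => h.count hD hu hx

lemma count_bypass (hs : s ∉ X) (hv : v ∈ verts n) :
    pathCount (attach r s (φ (cornerA n)) (φ (cornerB n))) (insert s X) (φ 0) (φ v) =
      bypass n v := by
  have hne : ∀ z ∈ verts n, z ≠ outer := fun z hz e => outer_notMem_verts (e ▸ hz)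
  have hφ : ∀ z ∈ verts n, Function.update φ outer s z = φ z := fun z hz =>
    Function.update_of_ne (hne z hz) _ _
  have hmem : ∀ z ∈ verts n, φ z ≠ s := fun z hz e =>
    hs (h.img ▸ e ▸ Finset.mem_image_of_mem φ hz)
  have himg : insert s X = (insert outer (verts n)).image (Function.update φ outer s) := by
    rw [Finset.image_insert, Function.update_self, h.img]
    congr 1
    exact Finset.image_congr fun z hz => (hφ z hz).symm
  rw [bypass, ← hφ 0 zero_mem_verts, ← hφ v hv, himg]
  refine pathCount_image _ ?_ ?_ (Finset.mem_insert_of_mem zero_mem_verts)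
    (Finset.mem_insert_of_mem hv)
  · intro x hx y hy e
    rcases Finset.mem_insert.1 hx with rfl | hx <;> rcases Finset.mem_insert.1 hy with rfl | hy
    · rfl
    · rw [Function.update_self, hφ y hy] at e
      exact absurd e.symm (hmem y hy)
    · rw [Function.update_self, hφ x hx] at e
      exact absurd e (hmem x hx)
    · rw [hφ x hx, hφ y hy] at e
      exact h.inj hx hy e
  · intro x hx y hy
    have hA := (corner_mem_verts (n := n)).1
    have hB := (corner_mem_verts (n := n)).2
    rcases Finset.mem_insert.1 hx with rfl | hx <;> rcases Finset.mem_insert.1 hy with rfl | hy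
    · rw [Function.update_self, attach_left, attach_left]
      constructor
      · rintro (e | e)
        · exact absurd e.symm (hmem _ hA)
        · exact absurd e.symm (hmem _ hB)
      · rintro (e | e)
        · exact absurd e.symm (hne _ hA)
        · exact absurd e.symm (hne _ hB)
    · rw [Function.update_self, hφ y hy, attach_left, attach_left, h.inj.eq_iff hy hA,
        h.inj.eq_iff hy hB]
    · rw [Function.update_self, hφ x hx, attach_right (hmem x hx), attach_right (hne x hx),
        h.inj.eq_iff hx hA, h.inj.eq_iff hx hB]
    · rw [hφ x hx, hφ y hy, attach_of_ne (hmem x hx) (hmem y hy),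
        attach_of_ne (hne x hx) (hne y hy), h.rel x hx y hy]

lemma comp {ψ : ℤ × ℤ → ℤ × ℤ} (hψ : Function.Bijective ψ)
    (hmem : ∀ x, ψ x ∈ verts n ↔ x ∈ verts n)
    (hadj : ∀ x y, latAdj n (ψ x) (ψ y) ↔ latAdj n x y) : CellMap n r X (φ ∘ ψ) where
  inj x hx y hy e := hψ.1 (h.inj ((hmem x).2 hx) ((hmem y).2 hy) e)
  img := by
    rw [h.img]
    ext z
    simp only [Finset.mem_image, Function.comp]
    constructor
    · rintro ⟨x, hx, rfl⟩
      obtain ⟨y, rfl⟩ := hψ.2 x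
      exact ⟨y, (hmem y).1 hx, rfl⟩
    · rintro ⟨x, hx, rfl⟩
      exact ⟨ψ x, (hmem x).2 hx, rfl⟩
  rel x hx y hy := by
    rw [Function.comp, Function.comp, h.rel _ ((hmem x).2 hx) _ ((hmem y).2 hy), hadj]

end CellMap

namespace Cell

lemma rot (h : Cell n r X p q w) : Cell n r X q w p := by
  obtain ⟨φ, h, rfl, rfl, rfl⟩ := h
  refine ⟨φ ∘ rotate n, h.comp ⟨rotate_injective, exists_rotate_eq⟩ (fun _ => rotate_mem_verts)
    (fun _ _ => rotate_latAdj), ?_, ?_, ?_⟩ <;>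
  exact congrArg φ (by ext <;> simp [rotate, cornerA, cornerB])

lemma swap (h : Cell n r X p q w) : Cell n r X p w q := by
  obtain ⟨φ, h, rfl, rfl, rfl⟩ := h
  exact ⟨φ ∘ Prod.swap, h.comp Prod.swap_bijective (fun _ => swap_mem_verts)
    (fun _ _ => swap_latAdj), rfl, rfl, rfl⟩

lemma congr (h : Cell n r X p q w) (hr : ∀ x ∈ X, ∀ y ∈ X, (r' x y ↔ r x y)) :
    Cell n r' X p q w := by
  obtain ⟨φ, h, h'⟩ := h
  refine ⟨φ, ⟨h.inj, h.img, fun x hx y hy => ?_⟩, h'⟩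
  rw [hr _ (h.img ▸ Finset.mem_image_of_mem φ hx) _ (h.img ▸ Finset.mem_image_of_mem φ hy),
    h.rel x hx y hy]

lemma mem (h : Cell n r X p q w) : p ∈ X ∧ q ∈ X ∧ w ∈ X := by
  obtain ⟨φ, h, rfl, rfl, rfl⟩ := h
  rw [h.img]
  exact ⟨Finset.mem_image_of_mem _ zero_mem_verts, Finset.mem_image_of_mem _ corner_mem_verts.1,
    Finset.mem_image_of_mem _ corner_mem_verts.2⟩

lemma count (h : Cell n r X p q w) : pathCount r X p q = cornerPaths n := by
  obtain ⟨φ, h, rfl, rfl, rfl⟩ := h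
  rw [h.img]
  exact h.count (Finset.Subset.refl _) zero_mem_verts corner_mem_verts.1

lemma count_erase (h : Cell n r X p q w) : pathCount r (X.erase w) p q = cornerPathsDel n := by
  obtain ⟨φ, h, rfl, rfl, rfl⟩ := h
  rw [h.img, h.image_erase (Finset.Subset.refl _) corner_mem_verts.2]
  exact h.count (Finset.erase_subset _ _) zero_mem_verts corner_mem_verts.1

lemma sum (h : Cell n r X p q w) : ∑ x ∈ X, pathCount r X p x = sumF n := by
  obtain ⟨φ, h, rfl, rfl, rfl⟩ := h
  rw [sumF, ← h.sum (Finset.Subset.refl _) zero_mem_verts, ← h.img]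

lemma sum_erase (h : Cell n r X p q w) : ∑ x ∈ X, pathCount r (X.erase q) p x = sumG n := by
  obtain ⟨φ, h, rfl, rfl, rfl⟩ := h
  rw [sumG, ← h.sum (Finset.erase_subset _ _) zero_mem_verts,
    ← h.image_erase (Finset.Subset.refl _) corner_mem_verts.1, ← h.img]

lemma sum_erase_erase (h : Cell n r X p q w) :
    ∑ x ∈ X, pathCount r ((X.erase q).erase w) p x = sumR n := by
  obtain ⟨φ, h, rfl, rfl, rfl⟩ := h
  rw [sumR, ← h.sum ((Finset.erase_subset _ _).trans (Finset.erase_subset _ _)) zero_mem_verts,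
    ← h.image_erase (Finset.erase_subset _ _) corner_mem_verts.2,
    ← h.image_erase (Finset.Subset.refl _) corner_mem_verts.1, ← h.img]

lemma sum_attach (h : Cell n r X p q w) (hs : s ∉ X) :
    ∑ x ∈ X, pathCount (attach r s q w) (insert s X) p x = sumT n := by
  obtain ⟨φ, h, rfl, rfl, rfl⟩ := h
  rw [sumT]
  conv_lhs => rw [show ∑ x ∈ X, pathCount (attach r s (φ (cornerA n)) (φ (cornerB n)))
    (insert s X) (φ 0) x = ∑ x ∈ (verts n).image φ, pathCount (attach r s (φ (cornerA n))
      (φ (cornerB n))) (insert s X) (φ 0) x by rw [← h.img]]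
  rw [Finset.sum_image h.inj]
  exact Finset.sum_congr rfl fun x hx => h.count_bypass hs hx

lemma exists_mem (h : Cell n r X p q w) (hn : 1 ≤ n) : ∃ t ∈ X, t ≠ p ∧ t ≠ q ∧ t ≠ w := by
  obtain ⟨φ, h, rfl, rfl, rfl⟩ := h
  have h2 := two_le_pow hn
  refine ⟨φ (1, 0), h.img ▸ Finset.mem_image_of_mem φ one_mem_verts, ?_, ?_, ?_⟩ <;> intro e
  · have := h.inj one_mem_verts zero_mem_verts e
    simp [Prod.ext_iff] at this
  · have := h.inj one_mem_verts corner_mem_verts.1 e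
    simp only [cornerA, Prod.mk.injEq] at this
    linarith [this.1]
  · have := h.inj one_mem_verts corner_mem_verts.2 e
    simp [cornerB] at this

lemma ne (h : Cell n r X p q w) : p ≠ q := by
  obtain ⟨φ, h, rfl, rfl, rfl⟩ := h
  intro e
  have := h.inj zero_mem_verts corner_mem_verts.1 e
  have h2 : (0 : ℤ) < 2 ^ n := by positivity
  exact h2.ne (Prod.ext_iff.1 this).1

lemma not_rel (h : Cell n r X p q w) (hn : 1 ≤ n) : ¬ r p q ∧ ¬ r q p := by
  obtain ⟨φ, h, rfl, rfl, rfl⟩ := h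
  rw [h.rel _ zero_mem_verts _ corner_mem_verts.1, h.rel _ corner_mem_verts.1 _ zero_mem_verts]
  exact (not_latAdj_of_far hn (.inl (by simp [cornerA]))).symm

lemma count_attach (h : Cell n r X p q w) (hn : 1 ≤ n) (hs : s ∉ X) :
    pathCount (attach r s q w) (insert s X) p q = cornerPathsDel n := by
  have hsp : s ≠ p := fun e => hs (e ▸ h.mem.1)
  have hsq : s ≠ q := fun e => hs (e ▸ h.mem.2.1)
  have hsw : s ≠ w := fun e => hs (e ▸ h.mem.2.2)
  have hqw : q ≠ w := h.rot.ne
  have hr : ∀ x ∈ X, ∀ y ∈ X, (attach r s q w x y ↔ r x y) := fun x hx y hy =>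
    attach_of_ne (fun e => hs (e ▸ hx)) (fun e => hs (e ▸ hy))
  have e1 : ({w, q, s} : Finset W).erase w = {q, s} := by
    rw [Finset.erase_insert]; simp [hqw.symm, hsw.symm]
  have e2 : ({w, q, s} : Finset W).erase q = {w, s} := by
    rw [Finset.insert_comm, Finset.erase_insert]; simp [hqw, hsq.symm]
  have h' := h.congr hr
  rw [pathCount_two_cut (X := X) (Y := {w, q, s}) (p := q) (q := w) ?_ hqw ?_ ?_
    (h'.rot.not_rel hn).1 (h'.rot.not_rel hn).2 h.mem.1 (by simp), e1, e2,
    h'.swap.count_erase,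
    pathCount_two_edges hqw.symm hsw.symm hsq.symm (by simp [attach_right hsw.symm])
      (by simp [attach_left]),
    pathCount_self_eq_zero (x := s) (by simp) hsq, pathCount_self_eq_zero (x := s) (by simp) hsq,
    pathCount_of_notMem_right (S := {w, s}) (by simp [hqw, hsq.symm])]
  · ring
  · intro z
    have := h.mem
    simp only [Finset.mem_insert, Finset.mem_singleton]
    constructor
    · rintro (h1 | h1) <;> simp [h1]
    · rintro (h1 | rfl | rfl | h1)
      · simp [h1]
      · simp [h.mem.2.2]
      · simp [h.mem.2.1]
      · simp [h1]
  · intro z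
    simp only [Finset.mem_insert, Finset.mem_singleton]
    constructor
    · rintro ⟨h1, rfl | rfl | rfl⟩
      · exact .inr rfl
      · exact .inl rfl
      · exact absurd h1 hs
    · rintro (rfl | rfl)
      · exact ⟨h.mem.2.1, by simp⟩
      · exact ⟨h.mem.2.2, by simp⟩
  · intro x hx y hy h1 h2
    simp only [Finset.mem_insert, Finset.mem_singleton, not_or] at hy h1
    rcases hy with rfl | rfl | rfl
    · exact absurd h.mem.2.2 h2
    · exact absurd h.mem.2.1 h2
    · rw [attach_left, attach_right h1.2.2]
      tauto

end Cell

end Cell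

section Step

variable {W : Type*} [DecidableEq W] {r r' : W → W → Prop} {S A B T X D : Finset W}
  {a b c a' b' s t t' u v p q w z : W} {n : ℕ}

lemma Triangle.sum_union (h : Triangle r A B T a b c)
    (hS : ∀ w, w ∈ S ↔ w ∈ A ∨ w ∈ B ∨ w ∈ T) (φ : W → ℕ) :
    ∑ x ∈ S, φ x + φ a + φ b + φ c = ∑ x ∈ A, φ x + ∑ x ∈ B, φ x + ∑ x ∈ T, φ x := by
  have e1 : S = A ∪ (B ∪ T) := by ext w; simp [hS]
  have e2 : A ∩ (B ∪ T) = {a, b} := by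
    ext w
    rw [Finset.mem_inter, h.mem_inter_union]
    simp
  have e3 : B ∩ T = {c} := by
    ext w
    rw [Finset.mem_inter, h.memBT, Finset.mem_singleton]
  have h1 := Finset.sum_union_inter (s₁ := A) (s₂ := B ∪ T) (f := φ)
  have h2 := Finset.sum_union_inter (s₁ := B) (s₂ := T) (f := φ)
  rw [e2, Finset.sum_pair h.hab, ← e1] at h1
  rw [e3, Finset.sum_singleton] at h2
  omega

lemma sum_count_erase (ht : t ∉ D) :
    ∑ x ∈ X.erase t, pathCount r D u x = ∑ x ∈ X, pathCount r D u x := by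
  refine Finset.sum_subset (Finset.erase_subset _ _) fun x hx hx' => ?_
  have : x = t := by
    by_contra hne
    exact hx' (Finset.mem_erase.2 ⟨hne, hx⟩)
  exact pathCount_of_notMem_right (this ▸ ht)

/-- The number of paths starting in the first part of a triangle. -/
lemma Triangle.sum_count (h : Triangle r A B T a b c)
    (hS : ∀ w, w ∈ S ↔ w ∈ A ∨ w ∈ B ∨ w ∈ T)
    (ht : t ∈ B ∧ t ≠ a ∧ t ≠ c) (ht' : t' ∈ T ∧ t' ≠ b ∧ t' ≠ c)
    (hs : s ∉ A) {k l : ℕ} (h1 : pathCount r B a c = k) (h1' : pathCount r B c a = k)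
    (h2 : pathCount r T b c = l) (h2' : pathCount r T c b = l) (hu : u ∈ A) :
    ∑ x ∈ S, pathCount r S u x + k * l * (pathCount (attach r s a b) (insert s A) u a +
        pathCount (attach r s a b) (insert s A) u b) =
      k * l * ∑ x ∈ A, pathCount (attach r s a b) (insert s A) u x +
      l * (pathCount r A u b * ∑ x ∈ B, pathCount r (B.erase a) c x +
        pathCount r (A.erase a) u b * ∑ x ∈ B, pathCount r B c x) +
      k * (pathCount r A u a * ∑ x ∈ T, pathCount r (T.erase b) c x +
        pathCount r (A.erase b) u a * ∑ x ∈ T, pathCount r T c x) := by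
  have hsum := h.sum_union hS (pathCount r S u)
  have hS' : ∀ w, w ∈ S ↔ w ∈ A ∨ w ∈ T ∨ w ∈ B := fun w => by rw [hS, or_comm (a := w ∈ B)]
  have hA : ∀ x ∈ A, pathCount r S u x =
      k * l * pathCount (attach r s a b) (insert s A) u x := fun x hx =>
    h.count_base hS hs (by rw [h2, h1', mul_comm]) (by rw [h1, h2']) hu hx
  have hB := fun x (hx : x ∈ B) => h.count_side hS ht'.1 ht'.2.1 ht'.2.2 hu hx
  have hT := fun x (hx : x ∈ T) => h.swap.count_side hS' ht.1 ht.2.1 ht.2.2 hu hx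
  have hc : pathCount r S u c = 0 := by
    rw [hB c h.cB, pathCount_self_eq_zero ht.1 ht.2.2,
      pathCount_self_eq_zero (Finset.mem_erase.2 ⟨ht.2.1, ht.1⟩) ht.2.2]
    simp
  rw [Finset.sum_congr rfl hA, Finset.sum_congr rfl hB, Finset.sum_congr rfl hT, hA a h.aA,
    hA b h.bA, hc, h1, h2, ← Finset.mul_sum, ← Finset.mul_sum, ← Finset.mul_sum,
    Finset.sum_add_distrib, Finset.sum_add_distrib, ← Finset.mul_sum, ← Finset.mul_sum,
    ← Finset.mul_sum, ← Finset.mul_sum] at hsum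
  rw [← hsum]
  ring

/-- Three copies of the level-`n` gasket arranged in a triangle. -/
structure Step (n : ℕ) (r : W → W → Prop) (A B T : Finset W) (z a b c a' b' : W) : Prop where
  hn : 1 ≤ n
  tri : Triangle r A B T a b c
  cA : Cell n r A z a b
  cB : Cell n r B a a' c
  cT : Cell n r T b b' c

namespace Step

variable (h : Step n r A B T z a b c a' b')
include h

lemma swap : Step n r A T B z b a c b' a' :=
  ⟨h.hn, h.tri.swap, h.cA.swap, h.cT, h.cB⟩

lemma a'_notMem : a' ∉ A ∧ a' ∉ T :=
  ⟨fun e => h.cB.ne.symm ((h.tri.memAB a').1 ⟨e, h.cB.mem.2.1⟩),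
    fun e => h.cB.rot.ne ((h.tri.memBT a').1 ⟨h.cB.mem.2.1, e⟩)⟩

lemma mem_erase_iff (hS : ∀ w, w ∈ S ↔ w ∈ A ∨ w ∈ B ∨ w ∈ T) (w : W) :
    w ∈ S.erase a' ↔ w ∈ A ∨ w ∈ B.erase a' ∨ w ∈ T := by
  have := h.a'_notMem
  simp only [Finset.mem_erase, hS]
  constructor
  · tauto
  · rintro (h1 | h1 | h1)
    · exact ⟨fun e => this.1 (e ▸ h1), .inl h1⟩
    · exact ⟨h1.1, .inr (.inl h1.2)⟩
    · exact ⟨fun e => this.2 (e ▸ h1), .inr (.inr h1)⟩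

lemma triB : Triangle r A (B.erase a') T a b c := h.tri.eraseB h.cB.ne.symm h.cB.rot.ne

lemma exists_mem_erase : ∃ t, t ∈ B.erase a' ∧ t ≠ a ∧ t ≠ c := by
  obtain ⟨t, ht, h1, h2, h3⟩ := h.cB.exists_mem h.hn
  exact ⟨t, Finset.mem_erase.2 ⟨h2, ht⟩, h1, h3⟩

lemma count (hS : ∀ w, w ∈ S ↔ w ∈ A ∨ w ∈ B ∨ w ∈ T) :
    pathCount r S z a' = 2 * cornerPaths n ^ 2 * cornerPathsDel n := by
  obtain ⟨t, ht, h1, h2⟩ := h.swap.exists_mem_erase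
  rw [h.tri.count_side hS (Finset.mem_of_mem_erase ht) h1 h2 h.cA.mem.1 h.cB.mem.2.1,
    h.cT.swap.count, h.cA.swap.count, h.cB.rot.rot.swap.count_erase, h.cA.swap.count_erase,
    h.cB.rot.rot.swap.count]
  ring

lemma count_erase (hS : ∀ w, w ∈ S ↔ w ∈ A ∨ w ∈ B ∨ w ∈ T) :
    pathCount r (S.erase b') z a' = 2 * cornerPaths n * cornerPathsDel n ^ 2 := by
  obtain ⟨t, ht, h1, h2⟩ := h.swap.exists_mem_erase
  have hS' : ∀ w, w ∈ S.erase b' ↔ w ∈ A ∨ w ∈ B ∨ w ∈ T.erase b' := fun w => by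
    rw [h.swap.mem_erase_iff (fun w => by rw [hS, or_comm (a := w ∈ B)]), or_comm (b := w ∈ B)]
  rw [h.swap.triB.swap.count_side hS' ht h1 h2 h.cA.mem.1 h.cB.mem.2.1,
    h.cT.swap.count_erase, h.cA.swap.count, h.cB.rot.rot.swap.count_erase, h.cA.swap.count_erase,
    h.cB.rot.rot.swap.count]
  ring

lemma sum_count (hS : ∀ w, w ∈ S ↔ w ∈ A ∨ w ∈ B ∨ w ∈ T) (hs : s ∉ A) :
    ∑ x ∈ S, pathCount r S z x + 2 * cornerPaths n ^ 2 * cornerPathsDel n =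
      2 * cornerPaths n * (cornerPaths n * sumG n + cornerPathsDel n * sumF n) +
        cornerPaths n ^ 2 * sumT n := by
  obtain ⟨t, ht, h1, h2⟩ := h.exists_mem_erase
  obtain ⟨t', ht', h1', h2'⟩ := h.swap.exists_mem_erase
  have key := h.tri.sum_count hS ⟨Finset.mem_of_mem_erase ht, h1, h2⟩
    ⟨Finset.mem_of_mem_erase ht', h1', h2'⟩ hs h.cB.swap.count h.cB.rot.rot.count
    h.cT.swap.count h.cT.rot.rot.count h.cA.mem.1
  have e : pathCount (attach r s a b) (insert s A) z b = cornerPathsDel n := by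
    rw [← h.cA.swap.count_attach h.hn hs]
    exact pathCount_congr fun x _ y _ => by simp only [attach, or_comm]
  rw [h.cA.count_attach h.hn hs, e, h.cA.sum_attach hs, h.cA.count, h.cA.swap.count,
    h.cA.count_erase, h.cA.swap.count_erase, h.cB.rot.rot.sum_erase, h.cB.rot.rot.sum,
    h.cT.rot.rot.sum_erase, h.cT.rot.rot.sum] at key
  linarith

lemma sum_count_erase_right (hS : ∀ w, w ∈ S ↔ w ∈ A ∨ w ∈ B ∨ w ∈ T) (hs : s ∉ A) :
    ∑ x ∈ S, pathCount r (S.erase a') z x + 2 * cornerPaths n * cornerPathsDel n ^ 2 =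
      cornerPathsDel n * (cornerPaths n * sumG n + cornerPathsDel n * sumF n) +
        cornerPaths n * (cornerPaths n * sumR n + cornerPathsDel n * sumG n) +
        cornerPaths n * cornerPathsDel n * sumT n := by
  obtain ⟨t, ht, h1, h2⟩ := h.exists_mem_erase
  obtain ⟨t', ht', h1', h2'⟩ := h.swap.exists_mem_erase
  have key := h.triB.sum_count (h.mem_erase_iff hS) ⟨ht, h1, h2⟩
    ⟨Finset.mem_of_mem_erase ht', h1', h2'⟩ hs h.cB.swap.count_erase h.cB.rot.rot.count_erase
    h.cT.swap.count h.cT.rot.rot.count h.cA.mem.1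
  have e : pathCount (attach r s a b) (insert s A) z b = cornerPathsDel n := by
    rw [← h.cA.swap.count_attach h.hn hs]
    exact pathCount_congr fun x _ y _ => by simp only [attach, or_comm]
  rw [SierpinskiGasket.sum_count_erase (by simp), SierpinskiGasket.sum_count_erase (by simp),
    SierpinskiGasket.sum_count_erase (by simp), Finset.erase_right_comm,
    h.cA.count_attach h.hn hs, e, h.cA.sum_attach hs, h.cA.count, h.cA.swap.count,
    h.cA.count_erase, h.cA.swap.count_erase, h.cB.rot.rot.sum_erase_erase,
    h.cB.rot.rot.swap.sum_erase, h.cT.rot.rot.sum_erase, h.cT.rot.rot.sum] at key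
  linarith

lemma sum_count_erase_erase (hS : ∀ w, w ∈ S ↔ w ∈ A ∨ w ∈ B ∨ w ∈ T) (hs : s ∉ A) :
    ∑ x ∈ S, pathCount r ((S.erase a').erase b') z x + 2 * cornerPathsDel n ^ 3 =
      2 * cornerPathsDel n * (cornerPaths n * sumR n + cornerPathsDel n * sumG n) +
        cornerPathsDel n ^ 2 * sumT n := by
  obtain ⟨t, ht, h1, h2⟩ := h.exists_mem_erase
  obtain ⟨t', ht', h1', h2'⟩ := h.swap.exists_mem_erase
  have htri : Triangle r A (B.erase a') (T.erase b') a b c :=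
    h.triB.eraseT h.cT.ne.symm h.cT.rot.ne
  have hS' : ∀ w, w ∈ (S.erase a').erase b' ↔ w ∈ A ∨ w ∈ B.erase a' ∨ w ∈ T.erase b' := by
    intro w
    have hb := h.swap.a'_notMem
    rw [Finset.mem_erase, h.mem_erase_iff hS, Finset.mem_erase (s := T)]
    constructor
    · rintro ⟨h1, h2 | h2 | h2⟩
      · exact .inl h2
      · exact .inr (.inl h2)
      · exact .inr (.inr ⟨h1, h2⟩)
    · rintro (h2 | h2 | h2)
      · exact ⟨fun e => hb.1 (e ▸ h2), .inl h2⟩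
      · exact ⟨fun e => hb.2 (e ▸ Finset.mem_of_mem_erase h2), .inr (.inl h2)⟩
      · exact ⟨h2.1, .inr (.inr h2.2)⟩
  have key := htri.sum_count hS' ⟨ht, h1, h2⟩ ⟨ht', h1', h2'⟩ hs h.cB.swap.count_erase
    h.cB.rot.rot.count_erase h.cT.swap.count_erase h.cT.rot.rot.count_erase h.cA.mem.1
  have e : pathCount (attach r s a b) (insert s A) z b = cornerPathsDel n := by
    rw [← h.cA.swap.count_attach h.hn hs]
    exact pathCount_congr fun x _ y _ => by simp only [attach, or_comm]
  have e1 : ∑ x ∈ (S.erase a').erase b', pathCount r ((S.erase a').erase b') z x =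
      ∑ x ∈ S, pathCount r ((S.erase a').erase b') z x := by
    rw [SierpinskiGasket.sum_count_erase (by simp), SierpinskiGasket.sum_count_erase (by simp)]
  have e2 : (B.erase a').erase a = (B.erase a).erase a' := Finset.erase_right_comm
  have e3 : (T.erase b').erase b = (T.erase b).erase b' := Finset.erase_right_comm
  rw [e1, SierpinskiGasket.sum_count_erase (X := B) (by simp),
    SierpinskiGasket.sum_count_erase (X := B) (by simp),
    SierpinskiGasket.sum_count_erase (X := T) (by simp),
    SierpinskiGasket.sum_count_erase (X := T) (by simp), e2, e3,
    h.cA.count_attach h.hn hs, e, h.cA.sum_attach hs, h.cA.count, h.cA.swap.count,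
    h.cA.count_erase, h.cA.swap.count_erase, h.cB.rot.rot.sum_erase_erase,
    h.cB.rot.rot.swap.sum_erase, h.cT.rot.rot.sum_erase_erase, h.cT.rot.rot.swap.sum_erase] at key
  linarith

end Step
end Step

section BridgedStep

variable {W : Type*} [DecidableEq W] {r r' : W → W → Prop} {S A B T X D : Finset W}
  {a b c a' b' s t t' u v p q w z : W} {n : ℕ}

lemma attach_iff_of_notMem {x y : W} (hs : s ∉ X) (hx : x ∈ X) (hy : y ∈ X) :
    attach r s q w x y ↔ r x y :=
  attach_of_ne (fun e => hs (e ▸ hx)) (fun e => hs (e ▸ hy))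

lemma attach_swap : attach r s q w = attach r s w q := by
  funext x y
  simp only [attach, or_comm]

lemma attach_attach {q' w' : W} : attach (attach r s q' w') s q w = attach r s q w := by
  funext x y
  by_cases hx : x = s <;> by_cases hy : y = s <;> simp [attach, hx, hy]

namespace Step

variable (h : Step n r A B T z a b c a' b') (hsA : s ∉ A) (hsB : s ∉ B) (hsT : s ∉ T)
include h hsA hsB hsT

lemma attach : Step n (attach r s a' b') A B T z a b c a' b' where
  hn := h.hn
  tri := 
    { h.tri with
      rAB := fun x hx y hy h1 h2 => by
        have e1 : x ≠ s := fun e => hsA (e ▸ hx)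
        have e2 : y ≠ s := fun e => hsB (e ▸ hy)
        rw [attach_of_ne e1 e2, attach_of_ne e2 e1]
        exact h.tri.rAB x hx y hy h1 h2
      rAT := fun x hx y hy h1 h2 => by
        have e1 : x ≠ s := fun e => hsA (e ▸ hx)
        have e2 : y ≠ s := fun e => hsT (e ▸ hy)
        rw [attach_of_ne e1 e2, attach_of_ne e2 e1]
        exact h.tri.rAT x hx y hy h1 h2
      rBT := fun x hx y hy h1 h2 => by
        have e1 : x ≠ s := fun e => hsB (e ▸ hx)
        have e2 : y ≠ s := fun e => hsT (e ▸ hy)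
        rw [attach_of_ne e1 e2, attach_of_ne e2 e1]
        exact h.tri.rBT x hx y hy h1 h2 }
  cA := h.cA.congr fun x hx y hy => attach_iff_of_notMem hsA hx hy
  cB := h.cB.congr fun x hx y hy => attach_iff_of_notMem hsB hx hy
  cT := h.cT.congr fun x hx y hy => attach_iff_of_notMem hsT hx hy

lemma bridge : Bridge (SierpinskiGasket.attach r s a' b') B T s c a' b' where
  memBT := h.tri.memBT
  rBT := (h.attach hsA hsB hsT).tri.rBT
  ha' := h.cB.mem.2.1
  hb' := h.cT.mem.2.1
  a'_ne := h.cB.rot.ne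
  b'_ne := h.cT.rot.ne
  hsB := hsB
  hsT := hsT
  rsB _ hx := ⟨attach_right fun e => hsB (e ▸ hx), attach_left⟩
  rsT _ hx := ⟨attach_right fun e => hsT (e ▸ hx), attach_left⟩
  rca := ((h.attach hsA hsB hsT).cB.rot.not_rel h.hn).symm

lemma bridged :
    BridgedTriangle (SierpinskiGasket.attach r s a' b') A B T a b c s a' b' where
  tri := (h.attach hsA hsB hsT).tri
  br := h.bridge hsA hsB hsT
  br' := attach_swap (r := r) (s := s) (q := a') (w := b') ▸ h.swap.bridge hsA hsT hsB
  hsA := hsA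
  rsA x hx := by
    have h1 : x ≠ a' := fun e => h.a'_notMem.1 (e ▸ hx)
    have h2 : x ≠ b' := fun e => h.swap.a'_notMem.1 (e ▸ hx)
    have h3 : x ≠ s := fun e => hsA (e ▸ hx)
    rw [attach_right h3, attach_left]
    tauto
  haa' := h.cB.ne
  hbb' := h.cT.ne

variable (hS : ∀ w, w ∈ S ↔ w ∈ A ∨ w ∈ B ∨ w ∈ T)
include hS

lemma count_attach_base (hv : v ∈ A) :
    pathCount (SierpinskiGasket.attach r s a' b') (insert s S) z v =
      2 * cornerPaths n * cornerPathsDel n *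
        pathCount (SierpinskiGasket.attach r s a b) (insert s A) z v := by
  have h2 := h.attach hsA hsB hsT
  have hS' : ∀ w, w ∈ insert s S ↔ w ∈ A ∨ w ∈ insert s (B ∪ T) := fun w => by
    simp only [Finset.mem_insert, hS, Finset.mem_union]; tauto
  rw [(h.bridged hsA hsB hsT).count_base hS' (m := 2 * cornerPaths n * cornerPathsDel n) ?_ ?_
    h.cA.mem.1 hv, attach_attach]
  · rw [h2.cB.count, h2.cB.count_erase, h2.cT.rot.swap.count, h2.cT.rot.swap.count_erase]
    ring
  · rw [h2.cT.count, h2.cT.count_erase, h2.cB.rot.swap.count, h2.cB.rot.swap.count_erase]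
    ring

lemma count_attach_side (hv : v ∈ B) :
    pathCount (SierpinskiGasket.attach r s a' b') (insert s S) z v =
      2 * cornerPaths n * cornerPathsDel n *
        pathCount (SierpinskiGasket.attach r s a' c) (insert s B) a v +
      cornerPaths n * (cornerPaths n * pathCount r ((B.erase a).erase c) a' v +
        cornerPathsDel n * pathCount r (B.erase a) a' v) +
      cornerPathsDel n * (cornerPaths n * pathCount r (B.erase c) a' v +
        cornerPathsDel n * pathCount r B a' v) := by
  have h2 := h.attach hsA hsB hsT
  have hS' : ∀ w, w ∈ insert s S ↔ w ∈ A ∨ w ∈ insert s (B ∪ T) := fun w => by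
    simp only [Finset.mem_insert, hS, Finset.mem_union]; tauto
  have e : ∀ D ⊆ B, pathCount (SierpinskiGasket.attach r s a' b') D a' v = pathCount r D a' v :=
    fun D hD => pathCount_congr fun x hx y hy => attach_iff_of_notMem hsB (hD hx) (hD hy)
  rw [(h.bridged hsA hsB hsT).count_side hS' h2.cT.rot.rot.swap.count_erase
    h2.cT.rot.count_erase h2.cT.rot.rot.swap.count h2.cT.rot.count h.cA.mem.1 hv,
    attach_attach, h2.cA.count, h2.cA.swap.count, h2.cA.count_erase, h2.cA.swap.count_erase,
    h2.cT.count, h2.cT.count_erase, e _ (Finset.Subset.refl _), e _ (Finset.erase_subset _ _),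
    e _ (Finset.erase_subset _ _),
    e _ ((Finset.erase_subset _ _).trans (Finset.erase_subset _ _)), attach_swap]
  ring

lemma sum_count_attach_side :
    ∑ x ∈ B, pathCount (SierpinskiGasket.attach r s a' b') (insert s S) z x =
      2 * cornerPaths n * cornerPathsDel n * sumT n +
      (cornerPaths n ^ 2 * sumR n + 2 * cornerPaths n * cornerPathsDel n * sumG n +
        cornerPathsDel n ^ 2 * sumF n) := by
  rw [Finset.sum_congr rfl fun x hx => h.count_attach_side hsA hsB hsT hS hx]
  simp only [Finset.sum_add_distrib, ← Finset.mul_sum]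
  rw [h.cB.sum_attach hsB, Finset.erase_right_comm, h.cB.rot.sum_erase_erase, h.cB.rot.sum_erase,
    h.cB.rot.swap.sum_erase, h.cB.rot.sum]
  ring

lemma sum_count_attach :
    ∑ x ∈ S, pathCount (SierpinskiGasket.attach r s a' b') (insert s S) z x +
        8 * cornerPaths n * cornerPathsDel n ^ 2 =
      6 * cornerPaths n * cornerPathsDel n * sumT n +
      2 * (cornerPaths n ^ 2 * sumR n + 2 * cornerPaths n * cornerPathsDel n * sumG n +
        cornerPathsDel n ^ 2 * sumF n) := by
  have hsum := h.tri.sum_union hS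
    (pathCount (SierpinskiGasket.attach r s a' b') (insert s S) z)
  have hS' : ∀ w, w ∈ S ↔ w ∈ A ∨ w ∈ T ∨ w ∈ B := fun w => by rw [hS, or_comm (a := w ∈ B)]
  have hT := h.swap.sum_count_attach_side hsA hsT hsB hS'
  rw [attach_swap] at hT
  have ec : pathCount (SierpinskiGasket.attach r s a' b') (insert s S) z c =
      4 * cornerPaths n * cornerPathsDel n ^ 2 := by
    obtain ⟨t, ht, h1, h2⟩ := h.exists_mem_erase
    rw [h.count_attach_side hsA hsB hsT hS h.tri.cB, h.cB.rot.count,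
      attach_swap, h.cB.swap.count_attach h.hn hsB, pathCount_of_notMem_right (by simp),
      pathCount_of_notMem_right (S := B.erase c) (by simp), h.cB.rot.count_erase]
    ring
  have eb : pathCount (SierpinskiGasket.attach r s a b) (insert s A) z b = cornerPathsDel n := by
    rw [attach_swap, h.cA.swap.count_attach h.hn hsA]
  rw [h.sum_count_attach_side hsA hsB hsT hS, hT, ec,
    Finset.sum_congr rfl (fun x hx => h.count_attach_base hsA hsB hsT hS hx), ← Finset.mul_sum,
    h.cA.sum_attach hsA, h.count_attach_base hsA hsB hsT hS h.tri.aA,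
    h.count_attach_base hsA hsB hsT hS h.tri.bA, h.cA.count_attach h.hn hsA, eb] at hsum
  linarith

end Step
end BridgedStep

section Recursion

variable {n : ℕ} {x u v : ℤ × ℤ}

/-- The common corner of the two translates of the level-`n` gasket inside the level-`n + 1`
gasket. -/
def cornerC (n : ℕ) : ℤ × ℤ := (2 ^ n, 2 ^ n)

lemma cornerC_sub : cornerC n - cornerA n = cornerB n ∧ cornerC n - cornerB n = cornerA n := by
  constructor <;> ext <;> simp [cornerA, cornerB, cornerC]

lemma verts_inter (w : ℤ × ℤ) :
    (w ∈ verts n ∧ w - cornerA n ∈ verts n → w = cornerA n) ∧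
    (w ∈ verts n ∧ w - cornerB n ∈ verts n → w = cornerB n) ∧
    (w - cornerA n ∈ verts n ∧ w - cornerB n ∈ verts n → w = cornerC n) := by
  refine ⟨?_, ?_, ?_⟩ <;> rintro ⟨h1, h2⟩ <;> have h3 := verts_bounds h1 <;>
    have h4 := verts_bounds h2 <;>
    simp only [cornerA, cornerB, cornerC, Prod.fst_sub, Prod.snd_sub] at h3 h4 ⊢ <;>
    ext <;> simp only [] <;> linarith

lemma not_latAdj_corners (hn : 1 ≤ n) :
    (¬ latAdj n (cornerA n) (cornerB n) ∧ ¬ latAdj n (cornerB n) (cornerA n)) ∧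
    (¬ latAdj n 0 (cornerA n) ∧ ¬ latAdj n (cornerA n) 0) ∧
    (¬ latAdj n 0 (cornerB n) ∧ ¬ latAdj n (cornerB n) 0) :=
  ⟨not_latAdj_of_far hn (.inl (by simp [cornerA, cornerB])),
    (not_latAdj_of_far hn (.inl (by simp [cornerA]))).symm,
    (not_latAdj_of_far hn (.inr (by simp [cornerB]))).symm⟩

lemma triangle_verts (hn : 1 ≤ n) : Triangle (latAdj (n + 1)) (verts n)
    ((verts n).image (· + cornerA n)) ((verts n).image (· + cornerB n))
    (cornerA n) (cornerB n) (cornerC n) := by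
  have hN := two_le_pow hn
  obtain ⟨hAB, h0A, h0B⟩ := not_latAdj_corners hn
  have symm_not : ∀ {x y}, ¬ latAdj (n + 1) x y → ¬ latAdj (n + 1) x y ∧ ¬ latAdj (n + 1) y x :=
    fun h => ⟨h, fun h' => h (latAdj_symm h')⟩
  refine ⟨fun w => ?_, fun w => ?_, fun w => ?_, ?_, ?_, ?_, ?_, ?_, ?_⟩
  · rw [mem_image_add]
    refine ⟨(verts_inter w).1, ?_⟩
    rintro rfl
    rw [sub_self]
    exact ⟨corner_mem_verts.1, zero_mem_verts⟩
  · rw [mem_image_add]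
    refine ⟨(verts_inter w).2.1, ?_⟩
    rintro rfl
    rw [sub_self]
    exact ⟨corner_mem_verts.2, zero_mem_verts⟩
  · rw [mem_image_add, mem_image_add]
    refine ⟨(verts_inter w).2.2, ?_⟩
    rintro rfl
    rw [cornerC_sub.1, cornerC_sub.2]
    exact corner_mem_verts.symm
  · intro e
    have := (Prod.ext_iff.1 e).1
    simp only [cornerA, cornerB] at this
    linarith
  · intro e
    have := (Prod.ext_iff.1 e).2
    simp only [cornerA, cornerC] at this
    linarith
  · intro e
    have := (Prod.ext_iff.1 e).1
    simp only [cornerB, cornerC] at this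
    linarith
  · intro x hx y hy h1 h2
    rw [mem_image_add] at hy
    refine symm_not ?_
    rintro (h | h | h)
    · exact h2 ((verts_inter y).1 ⟨(latAdj_mem h).2.1, hy⟩)
    · exact h1 ((verts_inter x).1 ⟨hx, (latAdj_mem h).1⟩)
    · rw [(verts_inter x).2.1 ⟨hx, (latAdj_mem h).1⟩,
        (verts_inter y).2.2 ⟨hy, (latAdj_mem h).2.1⟩, sub_self, cornerC_sub.2] at h
      exact h0A.1 h
  · intro x hx y hy h1 h2
    rw [mem_image_add] at hy
    refine symm_not ?_
    rintro (h | h | h)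
    · exact h2 ((verts_inter y).2.1 ⟨(latAdj_mem h).2.1, hy⟩)
    · rw [(verts_inter x).1 ⟨hx, (latAdj_mem h).1⟩,
        (verts_inter y).2.2 ⟨(latAdj_mem h).2.1, hy⟩, sub_self, cornerC_sub.1] at h
      exact h0B.1 h
    · exact h1 ((verts_inter x).2.1 ⟨hx, (latAdj_mem h).1⟩)
  · intro x hx y hy h1 h2
    rw [mem_image_add] at hx hy
    refine symm_not ?_
    rintro (h | h | h)
    · rw [(verts_inter x).1 ⟨(latAdj_mem h).1, hx⟩,
        (verts_inter y).2.1 ⟨(latAdj_mem h).2.1, hy⟩] at h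
      exact hAB.1 h
    · exact h2 ((verts_inter y).2.2 ⟨(latAdj_mem h).2.1, hy⟩)
    · exact h1 ((verts_inter x).2.2 ⟨hx, (latAdj_mem h).1⟩)

lemma cellMap_id : CellMap n (latAdj (n + 1)) (verts n) id := by
  refine ⟨Function.injective_id.injOn, by simp, fun x hx y hy => ⟨?_, .inl⟩⟩
  rintro (h | h | h)
  · exact h
  · refine absurd ?_ (latAdj_mem h).2.2
    rw [id, id, (verts_inter x).1 ⟨hx, (latAdj_mem h).1⟩,
      (verts_inter y).1 ⟨hy, (latAdj_mem h).2.1⟩]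
  · refine absurd ?_ (latAdj_mem h).2.2
    rw [id, id, (verts_inter x).2.1 ⟨hx, (latAdj_mem h).1⟩,
      (verts_inter y).2.1 ⟨hy, (latAdj_mem h).2.1⟩]

lemma step_verts (hn : 1 ≤ n) : Step n (latAdj (n + 1)) (verts n)
    ((verts n).image (· + cornerA n)) ((verts n).image (· + cornerB n)) 0
    (cornerA n) (cornerB n) (cornerC n) (cornerA (n + 1)) (cornerB (n + 1)) where
  hn := hn
  tri := triangle_verts hn
  cA := ⟨id, cellMap_id, rfl, rfl, rfl⟩
  cB := by
    refine ⟨(· + cornerA n), ⟨(add_left_injective _).injOn, rfl, fun x hx y hy => ?_⟩,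
      zero_add _, ?_, ?_⟩
    · refine ⟨?_, fun h => .inr (.inl (by simpa using h))⟩
      have hx' : x + cornerA n - cornerA n ∈ verts n := by simpa using hx
      have hy' : y + cornerA n - cornerA n ∈ verts n := by simpa using hy
      rintro (h | h | h)
      · refine absurd ?_ (latAdj_mem h).2.2
        rw [(verts_inter _).1 ⟨(latAdj_mem h).1, hx'⟩, (verts_inter _).1 ⟨(latAdj_mem h).2.1, hy'⟩]
      · simpa using h
      · refine absurd ?_ (latAdj_mem h).2.2
        rw [(verts_inter _).2.2 ⟨hx', (latAdj_mem h).1⟩,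
          (verts_inter _).2.2 ⟨hy', (latAdj_mem h).2.1⟩]
    · ext <;> simp [cornerA, pow_succ]; ring
    · ext <;> simp [cornerA, cornerB, cornerC]
  cT := by
    have hcell : Cell n (latAdj (n + 1)) ((verts n).image (· + cornerB n)) (cornerB n)
        (cornerC n) (cornerB (n + 1)) := by
      refine ⟨(· + cornerB n), ⟨(add_left_injective _).injOn, rfl, fun x hx y hy => ?_⟩,
        zero_add _, ?_, ?_⟩
      · refine ⟨?_, fun h => .inr (.inr (by simpa using h))⟩
        have hx' : x + cornerB n - cornerB n ∈ verts n := by simpa using hx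
        have hy' : y + cornerB n - cornerB n ∈ verts n := by simpa using hy
        rintro (h | h | h)
        · refine absurd ?_ (latAdj_mem h).2.2
          rw [(verts_inter _).2.1 ⟨(latAdj_mem h).1, hx'⟩,
            (verts_inter _).2.1 ⟨(latAdj_mem h).2.1, hy'⟩]
        · refine absurd ?_ (latAdj_mem h).2.2
          rw [(verts_inter _).2.2 ⟨(latAdj_mem h).1, hx'⟩,
            (verts_inter _).2.2 ⟨(latAdj_mem h).2.1, hy'⟩]
        · simpa using h
      · ext <;> simp [cornerA, cornerB, cornerC]
      · ext <;> simp [cornerB, pow_succ]; ring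
    exact hcell.swap

lemma mem_verts_succ' (w : ℤ × ℤ) : w ∈ verts (n + 1) ↔
    w ∈ verts n ∨ w ∈ (verts n).image (· + cornerA n) ∨ w ∈ (verts n).image (· + cornerB n) := by
  rw [mem_verts_succ, mem_image_add, mem_image_add]

lemma outer_notMem_image : outer ∉ (verts n).image (· + cornerA n) ∧
    outer ∉ (verts n).image (· + cornerB n) := by
  constructor <;> intro h
  · exact outer_notMem_verts ((mem_verts_succ' _).2 (.inr (.inl h)))
  · exact outer_notMem_verts ((mem_verts_succ' _).2 (.inr (.inr h)))

lemma cornerPaths_succ (hn : 1 ≤ n) :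
    cornerPaths (n + 1) = 2 * cornerPaths n ^ 2 * cornerPathsDel n :=
  (step_verts hn).count mem_verts_succ'

lemma cornerPathsDel_succ (hn : 1 ≤ n) :
    cornerPathsDel (n + 1) = 2 * cornerPaths n * cornerPathsDel n ^ 2 :=
  (step_verts hn).count_erase mem_verts_succ'

lemma sumF_succ (hn : 1 ≤ n) : sumF (n + 1) + 2 * cornerPaths n ^ 2 * cornerPathsDel n =
    2 * cornerPaths n * (cornerPaths n * sumG n + cornerPathsDel n * sumF n) +
      cornerPaths n ^ 2 * sumT n :=
  (step_verts hn).sum_count mem_verts_succ' outer_notMem_verts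

lemma sumG_succ (hn : 1 ≤ n) : sumG (n + 1) + 2 * cornerPaths n * cornerPathsDel n ^ 2 =
    cornerPathsDel n * (cornerPaths n * sumG n + cornerPathsDel n * sumF n) +
      cornerPaths n * (cornerPaths n * sumR n + cornerPathsDel n * sumG n) +
      cornerPaths n * cornerPathsDel n * sumT n :=
  (step_verts hn).sum_count_erase_right mem_verts_succ' outer_notMem_verts

lemma sumR_succ (hn : 1 ≤ n) : sumR (n + 1) + 2 * cornerPathsDel n ^ 3 =
    2 * cornerPathsDel n * (cornerPaths n * sumR n + cornerPathsDel n * sumG n) +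
      cornerPathsDel n ^ 2 * sumT n :=
  (step_verts hn).sum_count_erase_erase mem_verts_succ' outer_notMem_verts

lemma sumT_succ (hn : 1 ≤ n) : sumT (n + 1) + 8 * cornerPaths n * cornerPathsDel n ^ 2 =
    6 * cornerPaths n * cornerPathsDel n * sumT n +
      2 * (cornerPaths n ^ 2 * sumR n + 2 * cornerPaths n * cornerPathsDel n * sumG n +
        cornerPathsDel n ^ 2 * sumF n) :=
  (step_verts hn).sum_count_attach outer_notMem_verts outer_notMem_image.1 outer_notMem_image.2
    mem_verts_succ'

lemma bypass_succ (hn : 1 ≤ n) (hv : v ∈ verts n) :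
    bypass (n + 1) v = 2 * cornerPaths n * cornerPathsDel n * bypass n v := by
  rw [bypass, (step_verts hn).count_attach_base outer_notMem_verts outer_notMem_image.1
    outer_notMem_image.2 mem_verts_succ' hv]
  congr 1
  exact cellMap_id.count_bypass outer_notMem_verts hv

lemma count_succ (hn : 1 ≤ n) (hv : v ∈ verts n) :
    pathCount (latAdj (n + 1)) (verts (n + 1)) 0 v = cornerPaths n ^ 2 * bypass n v := by
  have h := step_verts hn
  rw [h.tri.count_base mem_verts_succ' outer_notMem_verts (m := cornerPaths n ^ 2)
    (by rw [h.cT.swap.count, h.cB.rot.rot.count, pow_two])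
    (by rw [h.cB.swap.count, h.cT.rot.rot.count, pow_two]) zero_mem_verts hv]
  congr 1
  exact cellMap_id.count_bypass outer_notMem_verts hv

end Recursion

section Asymptotics

variable {n k : ℕ} {v : ℤ × ℤ}

lemma cornerPaths_pos (hn : 1 ≤ n) : 0 < cornerPaths n ∧ 0 < cornerPathsDel n := by
  have hv : ∀ x, x ∈ verts 1 ↔
      x = (0, 0) ∨ x = (1, 0) ∨ x = (0, 1) ∨ x = (1, 1) ∨ x = (2, 0) ∨ x = (0, 2) := by
    intro x
    simp [verts, cornerA, cornerB]
    tauto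
  induction n, hn using Nat.le_induction with
  | base =>
    have h1 := pathCount_pos_of_list (r := latAdj 1)
      [(0, 0), (1, 0), (0, 1), (0, 2), (1, 1), (2, 0)]
      (by simp [latAdj, verts, cornerA, cornerB]; exact .inl rfl) (by simp) (by simp)
    have h2 := pathCount_pos_of_list (r := latAdj 1)
      [(0, 0), (0, 1), (1, 0), (1, 1), (2, 0)]
      (by simp [latAdj, verts, cornerA, cornerB]; exact .inl rfl) (by simp) (by simp)
    constructor
    · have e : verts 1 = [(0, 0), (1, 0), (0, 1), (0, 2), (1, 1), (2, 0)].toFinset := by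
        ext x
        rw [hv]
        simp
        tauto
      rw [cornerPaths, e]
      exact h1
    · have e : (verts 1).erase (cornerB 1) =
          [(0, 0), (0, 1), (1, 0), (1, 1), (2, 0)].toFinset := by
        ext x
        rw [Finset.mem_erase, hv, show cornerB 1 = (0, 2) from rfl]
        obtain ⟨i, j⟩ := x
        simp only [List.mem_toFinset, List.mem_cons, List.not_mem_nil, Prod.mk.injEq, ne_eq,
          or_false]
        clear h1 h2 hv
        grind
      rw [cornerPathsDel, e]
      exact h2
  | succ n hn ih =>
    obtain ⟨h1, h2⟩ := ih
    rw [cornerPaths_succ hn, cornerPathsDel_succ hn]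
    constructor <;> positivity

/-- The ratio of `cornerPathsDel` to `cornerPaths`, which does not depend on the level. -/
def pathRatio : ℝ := cornerPathsDel 1 / cornerPaths 1

lemma pathRatio_pos : 0 < pathRatio := by
  obtain ⟨h1, h2⟩ := cornerPaths_pos le_rfl
  unfold pathRatio
  positivity

lemma cornerPathsDel_eq (hn : 1 ≤ n) : (cornerPathsDel n : ℝ) = pathRatio * cornerPaths n := by
  induction n, hn using Nat.le_induction with
  | base =>
    have : (cornerPaths 1 : ℝ) ≠ 0 := by exact_mod_cast (cornerPaths_pos le_rfl).1.ne'
    rw [pathRatio, div_mul_cancel₀ _ this]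
  | succ n hn ih =>
    rw [cornerPaths_succ hn, cornerPathsDel_succ hn]
    push_cast
    rw [ih]
    ring

lemma cornerPaths_succ_real (hn : 1 ≤ n) :
    (cornerPaths (n + 1) : ℝ) = 2 * pathRatio * cornerPaths n ^ 3 := by
  rw [cornerPaths_succ hn]
  push_cast
  rw [cornerPathsDel_eq hn]
  ring

/-- `sumF` relative to `cornerPaths`. -/
def relF (n : ℕ) : ℝ := sumF n / cornerPaths n

/-- `sumG` relative to `cornerPathsDel`. -/
def relG (n : ℕ) : ℝ := sumG n / (pathRatio * cornerPaths n)

/-- Normalised `sumR`. -/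
def relR (n : ℕ) : ℝ := sumR n / (pathRatio ^ 2 * cornerPaths n)

/-- Normalised `sumT`. -/
def relT (n : ℕ) : ℝ := sumT n / (pathRatio * cornerPaths n) - 2

lemma rel_succ (hn : 1 ≤ n) :
    relF (n + 1) = relG n + relF n + relT n / 2 ∧
    relG (n + 1) = (relF n + 2 * relG n + relR n + relT n) / 2 ∧
    relR (n + 1) = relR n + relG n + relT n / 2 ∧
    relT (n + 1) = 3 * relT n + relR n + 2 * relG n + relF n := by
  have hγ := pathRatio_pos
  have hc : (0 : ℝ) < cornerPaths n := by exact_mod_cast (cornerPaths_pos hn).1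
  have hF := congrArg (Nat.cast (R := ℝ)) (sumF_succ hn)
  have hG := congrArg (Nat.cast (R := ℝ)) (sumG_succ hn)
  have hR := congrArg (Nat.cast (R := ℝ)) (sumR_succ hn)
  have hT := congrArg (Nat.cast (R := ℝ)) (sumT_succ hn)
  push_cast at hF hG hR hT
  rw [cornerPathsDel_eq hn] at hF hG hR hT
  have hF' := eq_sub_of_add_eq hF
  have hG' := eq_sub_of_add_eq hG
  have hR' := eq_sub_of_add_eq hR
  have hT' := eq_sub_of_add_eq hT
  simp only [relF, relG, relR, relT, cornerPaths_succ_real hn, hF', hG', hR', hT']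
  refine ⟨?_, ?_, ?_, ?_⟩ <;> field_simp <;> ring

lemma one_le_relF (hn : 1 ≤ n) : 1 ≤ relF n := by
  have hc : (0 : ℝ) < cornerPaths n := by exact_mod_cast (cornerPaths_pos hn).1
  rw [relF, one_le_div hc]
  have : cornerPaths n ≤ sumF n := Finset.single_le_sum
    (f := fun x => pathCount (latAdj n) (verts n) 0 x) (fun _ _ => Nat.zero_le _)
    corner_mem_verts.1
  exact_mod_cast this

lemma cell_verts : Cell n (latAdj n) (verts n) 0 (cornerA n) (cornerB n) :=
  ⟨id, ⟨Function.injective_id.injOn, by simp, fun _ _ _ _ => Iff.rfl⟩, rfl, rfl, rfl⟩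

lemma relT_nonneg (hn : 1 ≤ n) : 0 ≤ relT n := by
  have hc : (0 : ℝ) < cornerPathsDel n := by exact_mod_cast (cornerPaths_pos hn).2
  have hA : bypass n (cornerA n) = cornerPathsDel n :=
    cell_verts.count_attach hn outer_notMem_verts
  have hB : bypass n (cornerB n) = cornerPathsDel n := by
    rw [bypass, attach_swap]
    exact cell_verts.swap.count_attach hn outer_notMem_verts
  have hne : cornerA n ≠ cornerB n := fun e => by simpa [cornerA, cornerB] using congrArg Prod.fst e
  have hsub : ({cornerA n, cornerB n} : Finset (ℤ × ℤ)) ⊆ verts n := by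
    simp [Finset.insert_subset_iff, corner_mem_verts]
  have h := Finset.sum_le_sum_of_subset (f := bypass n) hsub
  rw [Finset.sum_pair hne, hA, hB] at h
  have h' : (cornerPathsDel n : ℝ) + cornerPathsDel n ≤ sumT n := by exact_mod_cast h
  rw [relT, ← cornerPathsDel_eq hn, sub_nonneg, le_div_iff₀ hc]
  linarith

lemma relF_relT_eq : ∃ c κ μ : ℝ, 0 < c ∧ ∀ n, 2 ≤ n →
    relF n = c * 4 ^ n + κ ∧ relT n = 4 * c * 4 ^ n + μ := by
  have inv : ∀ n, 2 ≤ n → relF n - relR n = relF 2 - relR 2 ∧ relF n + relR n = 2 * relG n ∧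
      2 * relG n + relT n = (2 * relG 2 + relT 2) / 16 * 4 ^ n ∧
      relT n - 4 * relG n = relT 2 - 4 * relG 2 := by
    intro n hn
    induction n, hn using Nat.le_induction with
    | base =>
      obtain ⟨h1, h2, h3, -⟩ := rel_succ (n := 1) le_rfl
      norm_num at h1 h2 h3
      refine ⟨rfl, ?_, by ring, rfl⟩
      rw [h1, h2, h3]
      ring
    | succ n hn ih =>
      obtain ⟨h1, h2, h3, h4⟩ := rel_succ (n := n) (by omega)
      obtain ⟨i1, i2, i3, i4⟩ := ih
      refine ⟨by linarith, by linarith, ?_, by linarith⟩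
      rw [pow_succ]
      linarith
  have hpos : 0 < 2 * relG 2 + relT 2 := by
    obtain ⟨-, h2, -, h4⟩ := rel_succ (n := 1) le_rfl
    norm_num at h2 h4
    have hF := one_le_relF (n := 1) le_rfl
    have hT := relT_nonneg (n := 1) le_rfl
    have hγ := pathRatio_pos
    have hG : 0 ≤ relG 1 := by unfold relG; positivity
    have hR : 0 ≤ relR 1 := by unfold relR; positivity
    linarith
  refine ⟨(2 * relG 2 + relT 2) / 96, -(relT 2 - 4 * relG 2) / 6 + (relF 2 - relR 2) / 2,
    (relT 2 - 4 * relG 2) / 3, by positivity, fun n hn => ?_⟩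
  obtain ⟨i1, i2, i3, i4⟩ := inv n hn
  constructor <;> linarith

lemma bypass_eq (hk : 1 ≤ k) (hkn : k ≤ n) (hv : v ∈ verts k) :
    v ∈ verts n ∧ bypass n v * cornerPaths k = cornerPaths n * bypass k v := by
  induction n, hkn using Nat.le_induction with
  | base => exact ⟨hv, mul_comm _ _⟩
  | succ n hn ih =>
    refine ⟨mem_verts_succ.2 (.inl ih.1), ?_⟩
    rw [bypass_succ (hk.trans hn) ih.1, cornerPaths_succ (hk.trans hn), mul_assoc, ih.2]
    ring

/-- Number of Hamiltonian paths of the level-`n` gasket from `0` into the level-`k` gasket. -/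
def sumInner (n k : ℕ) : ℕ := ∑ x ∈ verts k, pathCount (latAdj n) (verts n) 0 x

lemma sumInner_div (hk : 1 ≤ k) (hkn : k < n) :
    (sumInner n k : ℝ) / sumF n = (relT k + 2) / (2 * relF n) := by
  obtain ⟨m, rfl⟩ : ∃ m, n = m + 1 := ⟨n - 1, by omega⟩
  have hm : 1 ≤ m := by omega
  have hγ := pathRatio_pos
  have hck : (0 : ℝ) < cornerPaths k := by exact_mod_cast (cornerPaths_pos hk).1
  have hcm : (0 : ℝ) < cornerPaths m := by exact_mod_cast (cornerPaths_pos hm).1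
  have key : sumInner (m + 1) k * cornerPaths k = cornerPaths m ^ 3 * sumT k := by
    rw [sumInner, sumT, Finset.sum_mul, Finset.mul_sum]
    refine Finset.sum_congr rfl fun v hv => ?_
    obtain ⟨h1, h2⟩ := bypass_eq hk (by omega : k ≤ m) hv
    rw [count_succ hm h1, mul_assoc, h2]
    ring
  have key' : (sumInner (m + 1) k : ℝ) = cornerPaths m ^ 3 * sumT k / cornerPaths k := by
    rw [eq_div_iff hck.ne']
    exact_mod_cast key
  have hF : (0 : ℝ) < sumF (m + 1) := by
    have h1 := one_le_relF (n := m + 1) (by omega)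
    rw [relF] at h1
    by_contra h
    have : (sumF (m + 1) : ℝ) = 0 := le_antisymm (not_lt.1 h) (Nat.cast_nonneg _)
    rw [this, zero_div] at h1
    linarith
  rw [key', relT, relF, cornerPaths_succ_real hm]
  field_simp
  ring

lemma sumInner_bound : ∃ C : ℝ, 0 ≤ C ∧ ∀ n k : ℕ, 1 ≤ k → k < n →
    |(sumInner n k : ℝ) / sumF n - 2 * 4 ^ k / 4 ^ n| ≤ C / 4 ^ n := by
  obtain ⟨c, κ, μ, hc, h⟩ := relF_relT_eq
  set M : ℝ := |κ| + |μ + 2| + |relT 1 + 2 - 16 * c| with hM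
  have hM0 : 0 ≤ M := by positivity
  refine ⟨(M + 4 * M) * (1 + M) / (2 * c), by positivity, fun n k hk hkn => ?_⟩
  have hs1 := one_le_relF (n := n) (by omega)
  have hs := (h n (by omega)).1
  have h4 : (0 : ℝ) < 4 ^ n := by positivity
  have hsM : |relF n - c * 4 ^ n| ≤ M := by
    rw [hs, add_sub_cancel_left]
    have := abs_nonneg (μ + 2)
    have := abs_nonneg (relT 1 + 2 - 16 * c)
    linarith
  have htM : |relT k + 2 - 4 * c * 4 ^ k| ≤ M := by
    have e1 := abs_nonneg (μ + 2)
    have e2 := abs_nonneg (relT 1 + 2 - 16 * c)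
    have e3 := abs_nonneg κ
    rcases Nat.lt_or_ge k 2 with hk2 | hk2
    · obtain rfl : k = 1 := by omega
      have : relT 1 + 2 - 4 * c * 4 ^ 1 = relT 1 + 2 - 16 * c := by ring
      rw [this]
      linarith
    · rw [(h k hk2).2, show 4 * c * 4 ^ k + μ + 2 - 4 * c * 4 ^ k = μ + 2 by ring]
      linarith
  have hlow : c * 4 ^ n ≤ (1 + M) * relF n := by
    have := (abs_le.1 hsM).1
    nlinarith
  have hle : (4 : ℝ) ^ k / 4 ^ n ≤ 1 :=
    (div_le_one h4).2 (pow_le_pow_right₀ (by norm_num) hkn.le)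
  have hnum : |relT k + 2 - 4 * (4 ^ k / 4 ^ n) * relF n| ≤ M + 4 * M := by
    have e : relT k + 2 - 4 * (4 ^ k / 4 ^ n) * relF n =
        (relT k + 2 - 4 * c * 4 ^ k) - 4 * (4 ^ k / 4 ^ n) * (relF n - c * 4 ^ n) := by
      field_simp
      ring
    rw [e]
    refine (abs_sub _ _).trans (add_le_add htM ?_)
    rw [abs_mul, abs_of_nonneg (by positivity)]
    have : 4 * ((4 : ℝ) ^ k / 4 ^ n) ≤ 4 := by linarith
    exact mul_le_mul this hsM (abs_nonneg _) (by norm_num)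
  have hs0 : 0 < relF n := by linarith
  have e : (relT k + 2) / (2 * relF n) - 2 * 4 ^ k / 4 ^ n =
      (relT k + 2 - 4 * (4 ^ k / 4 ^ n) * relF n) / (2 * relF n) := by
    field_simp
    ring
  rw [sumInner_div hk hkn, e, abs_div, abs_of_pos (by positivity : 0 < 2 * relF n), div_div,
    div_le_div_iff₀ (by positivity) (by positivity)]
  calc _ ≤ (M + 4 * M) * (2 * (c * 4 ^ n)) := by
        rw [← mul_assoc 2 c]; gcongr
    _ ≤ (M + 4 * M) * (2 * ((1 + M) * relF n)) := by gcongr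
    _ = _ := by ring

lemma sumF_pos (hn : 1 ≤ n) : 0 < sumF n :=
  (cornerPaths_pos hn).1.trans_le (Finset.single_le_sum
    (f := fun x => pathCount (latAdj n) (verts n) 0 x) (fun _ _ => Nat.zero_le _)
    corner_mem_verts.1)

end Asymptotics

section Walks

variable {W : Type*} [DecidableEq W] {Γ : SimpleGraph W}

lemma card_walks_eq_pathCount (S : Finset W) (u v : W) :
    Finite {p : Γ.Walk u v // p.IsPath ∧ ∀ x, x ∈ p.support ↔ x ∈ S} ∧
    Nat.card {p : Γ.Walk u v // p.IsPath ∧ ∀ x, x ∈ p.support ↔ x ∈ S} =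
      pathCount Γ.Adj S u v := by
  induction hn : S.card using Nat.strong_induction_on generalizing S u with
  | _ m ih =>
  by_cases hu : u ∈ S
  swap
  · have : IsEmpty {p : Γ.Walk u v // p.IsPath ∧ ∀ x, x ∈ p.support ↔ x ∈ S} :=
      ⟨fun p => hu ((p.2.2 u).1 p.1.start_mem_support)⟩
    exact ⟨inferInstance, by rw [pathCount_of_notMem_left hu, Nat.card_of_isEmpty]⟩
  by_cases huv : u = v
  · subst huv
    by_cases hS : ∃ x ∈ S, x ≠ u
    · obtain ⟨x, hx, hxu⟩ := hS
      have : IsEmpty {p : Γ.Walk u u // p.IsPath ∧ ∀ x, x ∈ p.support ↔ x ∈ S} := by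
        refine ⟨fun p => hxu ?_⟩
        have h := (p.2.2 x).2 hx
        rw [(SimpleGraph.Walk.isPath_iff_nil.1 p.2.1).eq_nil] at h
        simpa using h
      exact ⟨inferInstance, by rw [pathCount_self_eq_zero hx hxu, Nat.card_of_isEmpty]⟩
    · push Not at hS
      obtain rfl : S = {u} := by ext x; simp only [Finset.mem_singleton]; grind
      have : Unique {p : Γ.Walk u u // p.IsPath ∧ ∀ x, x ∈ p.support ↔ x ∈ ({u} : Finset W)} :=
        { default := ⟨.nil, by simp⟩
          uniq := fun p => Subtype.ext (SimpleGraph.Walk.isPath_iff_nil.1 p.2.1).eq_nil }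
      exact ⟨inferInstance, by rw [pathCount_singleton, Nat.card_unique]⟩
  · have hrec := fun w => ih (S.erase u).card
      (hn ▸ Finset.card_erase_lt_of_mem hu) (S.erase u) w rfl
    let T := (S.erase u).filter (Γ.Adj u)
    let Φ : (Σ w : T, {p : Γ.Walk w.1 v // p.IsPath ∧ ∀ x, x ∈ p.support ↔ x ∈ S.erase u}) →
        {p : Γ.Walk u v // p.IsPath ∧ ∀ x, x ∈ p.support ↔ x ∈ S} := fun q =>
      ⟨.cons (Finset.mem_filter.1 q.1.2).2 q.2.1, by
        obtain ⟨w, p, hp, hs⟩ := q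
        refine ⟨(SimpleGraph.Walk.cons_isPath_iff _ _).2 ⟨hp, fun h => ?_⟩, fun x => ?_⟩
        · exact absurd ((hs u).1 h) (by simp)
        · rw [SimpleGraph.Walk.support_cons, List.mem_cons, hs, Finset.mem_erase]
          by_cases hx : x = u
          · simp [hx, hu]
          · simp [hx]⟩
    have hΦ : Function.Bijective Φ := by
      constructor
      · rintro ⟨⟨w, hw⟩, p, hp⟩ ⟨⟨w', hw'⟩, p', hp'⟩ e
        have e := congrArg Subtype.val e
        simp only [Φ] at e
        injection e with _ e1 _ e2
        subst e1
        obtain rfl := eq_of_heq e2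
        rfl
      · rintro ⟨p, hp, hs⟩
        cases p with
        | nil => exact absurd rfl huv
        | @cons _ w _ h q =>
          rw [SimpleGraph.Walk.cons_isPath_iff] at hp
          have hs' : ∀ x, x ∈ q.support ↔ x ∈ S.erase u := by
            intro x
            have := hs x
            rw [SimpleGraph.Walk.support_cons, List.mem_cons] at this
            rw [Finset.mem_erase, ← this]
            constructor
            · exact fun hx => ⟨fun e => hp.2 (e ▸ hx), .inr hx⟩
            · rintro ⟨h1, h2⟩
              exact h2.resolve_left h1
          exact ⟨⟨⟨w, Finset.mem_filter.2 ⟨(hs' w).1 q.start_mem_support, h⟩⟩, q, hp.1, hs'⟩, rfl⟩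
    have hfin := fun w : T => (hrec w.1).1
    refine ⟨Finite.of_surjective Φ hΦ.2, ?_⟩
    rw [← Nat.card_congr (Equiv.ofBijective Φ hΦ), Nat.card_sigma, pathCount_step hu huv,
      ← Finset.sum_filter, ← Finset.sum_coe_sort T]
    exact Finset.sum_congr rfl fun (w : T) _ => (hrec w.1).2

end Walks

section Embedding

variable {n k : ℕ} {u v x y d : ℤ × ℤ}

/-- The embedding of the triangular lattice into the plane. -/
def embed (x : ℤ × ℤ) : ℝ × ℝ := (x.1 + x.2 / 2, x.2 / 2 * sq3)

lemma sq3_pos : 0 < sq3 := Real.sqrt_pos.2 (by norm_num)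

lemma embed_injective : Function.Injective embed := by
  rintro ⟨i, j⟩ ⟨i', j'⟩ h
  simp only [embed, Prod.mk.injEq] at h
  obtain ⟨h1, h2⟩ := h
  have h3 : (j : ℝ) = j' := by
    have := mul_right_cancel₀ sq3_pos.ne' h2
    linarith
  have h4 : (i : ℝ) = i' := by rw [h3] at h1; linarith
  exact Prod.ext (by exact_mod_cast h4) (by exact_mod_cast h3)

lemma embed_add : embed (x + y) = embed x + embed y := by
  ext <;> simp [embed] <;> ring

lemma embed_zero : embed 0 = o := by simp [embed, o]

lemma embed_cornerA : embed (cornerA n) = a n := by simp [embed, cornerA, a]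

lemma embed_cornerB : embed (cornerB n) = b n := by simp [embed, cornerB, b]

lemma V_eq : V n = embed '' verts n := by
  induction n with
  | zero =>
    simp [V, verts, Set.image_insert_eq, ← embed_zero, ← embed_cornerA, ← embed_cornerB, cornerA,
      cornerB]
    rfl
  | succ n ih =>
    rw [V, ih, verts]
    push_cast
    simp only [Set.image_union, Set.image_image, embed_add, embed_cornerA, embed_cornerB]

lemma mem_map_embed (hd : ∀ u v, s(embed u, embed v) ∈ E n ↔ latAdj n u v) :
    s(embed u, embed v) ∈ Sym2.map (· + embed d) '' E n ↔ latAdj n (u - d) (v - d) := by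
  have hu : embed (u - d) + embed d = embed u := by rw [← embed_add, sub_add_cancel]
  have hv : embed (v - d) + embed d = embed v := by rw [← embed_add, sub_add_cancel]
  rw [← hd]
  constructor
  · rintro ⟨e, he, h⟩
    have hinj : Function.Injective (Sym2.map (· + embed d)) :=
      Sym2.map.injective (add_left_injective _)
    rwa [← hinj (a₁ := e) (a₂ := s(embed (u - d), embed (v - d))) (by
      rw [h, Sym2.map_mk]; simp [hu, hv])]
  · intro h
    exact ⟨_, h, by simp [hu, hv]⟩

lemma mem_E : (∀ u v, s(embed u, embed v) ∈ E n ↔ latAdj n u v) ∧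
    ∀ e ∈ E n, ∃ u v, e = s(embed u, embed v) := by
  induction n with
  | zero =>
    simp only [E, ← embed_zero, ← embed_cornerA, ← embed_cornerB]
    constructor
    · rintro u v
      simp only [Set.mem_insert_iff, Set.mem_singleton_iff, Sym2.eq_iff, embed_injective.eq_iff,
        latAdj, mem_verts_zero]
      simp only [cornerA, cornerB, pow_zero]
      obtain ⟨i, j⟩ := u
      obtain ⟨i', j'⟩ := v
      simp only [Prod.ext_iff, Prod.fst_zero, Prod.snd_zero, ne_eq]
      grind
    · rintro e (rfl | rfl | rfl) <;> exact ⟨_, _, rfl⟩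
  | succ n ih =>
    obtain ⟨h1, h2⟩ := ih
    simp only [E, ← embed_cornerA, ← embed_cornerB]
    constructor
    · intro u v
      rw [Set.mem_union, Set.mem_union, mem_map_embed h1, mem_map_embed h1, h1, latAdj,
        or_assoc]
    · rintro e ((he | ⟨e, he, rfl⟩) | ⟨e, he, rfl⟩)
      · exact h2 e he
      all_goals
        obtain ⟨u, v, rfl⟩ := h2 e he
        simp only [Sym2.map_mk, ← embed_add]
        exact ⟨_, _, rfl⟩

lemma G_adj : (G n).Adj (embed u) (embed v) ↔ latAdj n u v := by
  rw [G, SimpleGraph.fromEdgeSet_adj, mem_E.1]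
  exact ⟨And.left, fun h => ⟨h, fun e => (latAdj_mem h).2.2 (embed_injective e)⟩⟩

lemma f_embed (hu : u ∈ verts n) (hv : v ∈ verts n) :
    f n (embed u) (embed v) = pathCount (latAdj n) (verts n) u v := by
  rw [← pathCount_image (r' := (G n).Adj) embed embed_injective.injOn (fun _ _ _ _ => G_adj) hu hv,
    ← (card_walks_eq_pathCount _ _ _).2, f]
  simp only [IsHamPath, V_eq, ← Finset.coe_image, Finset.mem_coe]

lemma f_eq_zero {x y : ℝ × ℝ} (hy : y ∉ V n) : f n x y = 0 := by
  have : IsEmpty {p : (G n).Walk x y // IsHamPath n p} :=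
    ⟨fun p => hy ((p.2.2 y).1 p.1.end_mem_support)⟩
  rw [f, Nat.card_of_isEmpty]

lemma pathCount_zero_zero : pathCount (latAdj n) (verts n) 0 0 = 0 :=
  pathCount_self_eq_zero one_mem_verts (by simp [Prod.ext_iff])

lemma finsum_mem_eq_sum_verts {M : Type*} [AddCommMonoid M] {h : ℝ × ℝ → M} {s : Set (ℝ × ℝ)}
    (hV : ∀ y ∉ V n, h y = 0) (hs : ∀ y ∈ V n, (y ∈ s ↔ y ≠ o)) :
    ∑ᶠ y ∈ s, h y = ∑ x ∈ (verts n).erase 0, h (embed x) := by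
  rw [finsum_mem_inter_support_eq' h s (embed '' ((verts n).erase 0 : Finset (ℤ × ℤ))),
    finsum_mem_image embed_injective.injOn, finsum_mem_coe_finset]
  intro y hy
  have hyV : y ∈ V n := by_contra fun h' => hy (hV y h')
  rw [hs y hyV]
  rw [V_eq] at hyV
  obtain ⟨x, hx, rfl⟩ := hyV
  rw [embed_injective.mem_set_image, ← embed_zero, embed_injective.ne_iff, Finset.mem_coe,
    Finset.mem_erase]
  exact ⟨fun h' => ⟨h', hx⟩, And.left⟩

lemma f_o_embed (hx : x ∈ verts n) :
    f n o (embed x) = pathCount (latAdj n) (verts n) 0 x := by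
  rw [← embed_zero, f_embed zero_mem_verts hx]

lemma H0_eq : H0 n = sumF n := by
  rw [H0, finsum_mem_eq_sum_verts (s := {x | x ≠ o}) (fun y hy => f_eq_zero hy)
      (fun _ _ => Iff.rfl), sumF,
    ← Finset.sum_erase (a := 0) _ pathCount_zero_zero]
  exact Finset.sum_congr rfl fun x hx => f_o_embed (Finset.mem_of_mem_erase hx)

lemma xi_eq (ℓ : ℝ) : xi n ℓ = (∑ x ∈ (verts n).erase 0,
    enorm (embed x) ^ ℓ * pathCount (latAdj n) (verts n) 0 x) / sumF n := by
  rw [xi, finsum_mem_eq_sum_verts (n := n) (s := {x | x ∈ V n ∧ x ≠ o})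
    (fun y hy => by rw [p, f_eq_zero hy, Nat.cast_zero, zero_div, mul_zero])
    (fun y hy => and_iff_right hy), Finset.sum_div]
  refine Finset.sum_congr rfl fun x hx => ?_
  rw [p, f_o_embed (Finset.mem_of_mem_erase hx), H0_eq, mul_div_assoc]

end Embedding

section Displacement

variable {n k : ℕ} {x : ℤ × ℤ} {ℓ : ℝ}

lemma enorm_embed_sq : enorm (embed x) ^ 2 = (x.1 : ℝ) ^ 2 + x.1 * x.2 + (x.2 : ℝ) ^ 2 := by
  rw [enorm, Real.sq_sqrt (by positivity)]
  simp only [embed, mul_pow, sq3, Real.sq_sqrt (show (0 : ℝ) ≤ 3 by norm_num)]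
  ring

lemma enorm_nonneg (y : ℝ × ℝ) : 0 ≤ enorm y := Real.sqrt_nonneg _

lemma verts_bounds_real (hx : x ∈ verts n) :
    0 ≤ (x.1 : ℝ) ∧ 0 ≤ (x.2 : ℝ) ∧ (x.1 : ℝ) + x.2 ≤ 2 ^ n := by
  obtain ⟨h1, h2, h3⟩ := verts_bounds hx
  exact ⟨by exact_mod_cast h1, by exact_mod_cast h2, by exact_mod_cast h3⟩

lemma enorm_embed_le (hx : x ∈ verts n) : enorm (embed x) ≤ 2 ^ n := by
  obtain ⟨h1, h2, h3⟩ := verts_bounds_real hx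
  refine (pow_le_pow_iff_left₀ (enorm_nonneg _) (by positivity) two_ne_zero).1 ?_
  rw [enorm_embed_sq]
  have := pow_le_pow_left₀ (by positivity) h3 2
  nlinarith [mul_nonneg h1 h2]

lemma le_enorm_embed {t : ℝ} (ht : 0 ≤ t) (hx : x ∈ verts n)
    (h : t ≤ x.1 ∨ t ≤ x.2) : t ≤ enorm (embed x) := by
  obtain ⟨h1, h2, -⟩ := verts_bounds_real hx
  refine (pow_le_pow_iff_left₀ ht (enorm_nonneg _) two_ne_zero).1 ?_
  rw [enorm_embed_sq]
  rcases h with h | h <;> have := pow_le_pow_left₀ ht h 2 <;> nlinarith [mul_nonneg h1 h2]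

lemma one_le_enorm_embed (hx : x ∈ verts n) (h0 : x ≠ 0) : 1 ≤ enorm (embed x) := by
  obtain ⟨h1, h2, -⟩ := verts_bounds hx
  have : 1 ≤ x.1 ∨ 1 ≤ x.2 := by
    by_contra h
    exact h0 (Prod.ext (by simp; omega) (by simp; omega))
  exact le_enorm_embed zero_le_one hx (this.imp (by exact_mod_cast ·) (by exact_mod_cast ·))

lemma two_pow_le_enorm_embed (hx : x ∈ verts (n + 1)) (hn : x ∉ verts n) :
    2 ^ n ≤ enorm (embed x) := by
  refine le_enorm_embed (by positivity) hx ?_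
  rcases (mem_verts_succ.1 hx).resolve_left hn with h | h
  · have := (verts_bounds_real h).1
    simp only [cornerA, Prod.fst_sub] at this
    push_cast at this
    exact .inl (by linarith)
  · have := (verts_bounds_real h).2.1
    simp only [cornerB, Prod.snd_sub] at this
    push_cast at this
    exact .inr (by linarith)

lemma verts_mono (h : k ≤ n) (hx : x ∈ verts k) : x ∈ verts n := by
  induction n, h using Nat.le_induction with
  | base => exact hx
  | succ n _ ih => exact mem_verts_succ.2 (.inl ih)

/-- For `x` in the level-`n` gasket, the power `q ^ m` with `m` the least positive level whose
gasket contains `x`. -/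
def dyadicWeight (q : ℝ) (n : ℕ) (x : ℤ × ℤ) : ℝ :=
  q ^ n - (q - 1) * ∑ k ∈ Finset.Ico 1 n, if x ∈ verts k then q ^ k else 0

lemma enorm_rpow_bounds (hℓ : 0 < ℓ) (hn : 1 ≤ n) (hx : x ∈ verts n) (h0 : x ≠ 0) :
    enorm (embed x) ^ ℓ ≤ dyadicWeight (2 ^ ℓ) n x ∧
      dyadicWeight (2 ^ ℓ) n x ≤ 2 ^ ℓ * enorm (embed x) ^ ℓ := by
  have hpow : ∀ m : ℕ, ((2 : ℝ) ^ m) ^ ℓ = (2 ^ ℓ) ^ m := fun m => by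
    rw [← Real.rpow_natCast, ← Real.rpow_natCast, ← Real.rpow_mul (by norm_num),
      ← Real.rpow_mul (by norm_num), mul_comm]
  have hup : ∀ {m}, x ∈ verts m → enorm (embed x) ^ ℓ ≤ (2 ^ ℓ) ^ m := fun {m} h => by
    rw [← hpow]
    exact Real.rpow_le_rpow (enorm_nonneg _) (enorm_embed_le h) hℓ.le
  induction n, hn using Nat.le_induction with
  | base =>
    have hw : dyadicWeight (2 ^ ℓ) 1 x = (2 ^ ℓ) ^ 1 := by simp [dyadicWeight]
    rw [hw]
    refine ⟨hup hx, ?_⟩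
    rw [pow_one]
    exact le_mul_of_one_le_right (by positivity)
      (Real.one_le_rpow (one_le_enorm_embed hx h0) hℓ.le)
  | succ n hn ih =>
    by_cases hxn : x ∈ verts n
    · have hw : dyadicWeight (2 ^ ℓ) (n + 1) x = dyadicWeight (2 ^ ℓ) n x := by
        rw [dyadicWeight, dyadicWeight, Finset.sum_Ico_succ_top hn, if_pos hxn]
        ring
      rw [hw]
      exact ih hxn
    · have hw : dyadicWeight (2 ^ ℓ) (n + 1) x = (2 ^ ℓ) ^ (n + 1) := by
        rw [dyadicWeight, Finset.sum_eq_zero, mul_zero, sub_zero]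
        intro k hk
        exact if_neg fun h => hxn (verts_mono (by have := (Finset.mem_Ico.1 hk).2; omega) h)
      rw [hw]
      refine ⟨hup hx, ?_⟩
      rw [pow_succ, mul_comm, ← hpow]
      gcongr
      exact two_pow_le_enorm_embed hx hxn

/-- The mean of `dyadicWeight` over the end points of Hamiltonian paths starting in `0`. -/
def dyadicMean (q : ℝ) (n : ℕ) : ℝ :=
  q ^ n - (q - 1) * ∑ k ∈ Finset.Ico 1 n, q ^ k * ((sumInner n k : ℝ) / sumF n)

lemma dyadicMean_eq (q : ℝ) (hn : 1 ≤ n) : dyadicMean q n =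
    (∑ x ∈ (verts n).erase 0, dyadicWeight q n x * pathCount (latAdj n) (verts n) 0 x) /
      sumF n := by
  have hF : (sumF n : ℝ) ≠ 0 := by exact_mod_cast (sumF_pos hn).ne'
  rw [Finset.sum_erase _ (by rw [pathCount_zero_zero, Nat.cast_zero, mul_zero]), eq_div_iff hF]
  simp only [dyadicWeight, dyadicMean, sub_mul _ ((q - 1) * _), Finset.sum_sub_distrib]
  congr 1
  · rw [sumF, Nat.cast_sum, Finset.mul_sum]
  · simp only [mul_assoc, ← Finset.mul_sum, Finset.sum_mul]
    congr 1
    rw [Finset.sum_comm]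
    refine Finset.sum_congr rfl fun k hk => ?_
    have hsub : verts k ⊆ verts n := fun x hx => verts_mono (Finset.mem_Ico.1 hk).2.le hx
    simp only [ite_mul, zero_mul]
    rw [← Finset.sum_filter, Finset.filter_mem_eq_inter, Finset.inter_eq_right.2 hsub,
      div_mul_cancel₀ _ hF, sumInner, Nat.cast_sum, Finset.mul_sum]

lemma xi_dyadicMean (hℓ : 0 < ℓ) (hn : 1 ≤ n) :
    xi n ℓ ≤ dyadicMean (2 ^ ℓ) n ∧ dyadicMean (2 ^ ℓ) n ≤ 2 ^ ℓ * xi n ℓ := by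
  rw [dyadicMean_eq _ hn, xi_eq, ← mul_div_assoc, Finset.mul_sum]
  have h := fun x (hx : x ∈ (verts n).erase 0) => enorm_rpow_bounds hℓ hn
    (Finset.mem_of_mem_erase hx) (Finset.ne_of_mem_erase hx)
  constructor
  · gcongr with x hx
    exact (h x hx).1
  · refine div_le_div_of_nonneg_right (Finset.sum_le_sum fun x hx => ?_) (Nat.cast_nonneg _)
    rw [← mul_assoc]
    exact mul_le_mul_of_nonneg_right (h x hx).2 (Nat.cast_nonneg _)

lemma dyadicMean_asymptotics {q : ℝ} (hq : 1 < q) : ∃ C : ℝ, 0 < C ∧ ∀ n : ℕ, 1 ≤ n →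
    |dyadicMean q n - q ^ n * ((2 * q + 1) / (4 * q - 1))| ≤ q ^ n * (C / 4 ^ n) := by
  obtain ⟨C, hC, hbound⟩ := sumInner_bound
  refine ⟨C + 8 * q, by positivity, fun n hn => ?_⟩
  have hq1 : 0 < 4 * q - 1 := by linarith
  have hq2 : 0 < q - 1 := by linarith
  have h4 : (0 : ℝ) < 4 ^ n := by positivity
  set D : ℝ := ∑ k ∈ Finset.Ico 1 n, q ^ k * ((sumInner n k : ℝ) / sumF n - 2 * 4 ^ k / 4 ^ n)
    with hD
  have hDle : |(q - 1) * D| ≤ q ^ n * (C / 4 ^ n) := by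
    rw [abs_mul, abs_of_pos hq2]
    have h1 : |D| ≤ ∑ k ∈ Finset.Ico 1 n, q ^ k * (C / 4 ^ n) := by
      refine (Finset.abs_sum_le_sum_abs _ _).trans (Finset.sum_le_sum fun k hk => ?_)
      obtain ⟨hk1, hk2⟩ := Finset.mem_Ico.1 hk
      rw [abs_mul, abs_of_pos (by positivity)]
      exact mul_le_mul_of_nonneg_left (hbound n k hk1 hk2) (by positivity)
    calc (q - 1) * |D| ≤ (q - 1) * ∑ k ∈ Finset.Ico 1 n, q ^ k * (C / 4 ^ n) := by gcongr
      _ = (q ^ n - q ^ 1) * (C / 4 ^ n) := by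
        rw [← Finset.sum_mul, geom_sum_Ico hq.ne' hn]
        field_simp
      _ ≤ q ^ n * (C / 4 ^ n) := by
        gcongr
        linarith
  have hmain : dyadicMean q n - q ^ n * ((2 * q + 1) / (4 * q - 1)) =
      (q - 1) * (8 * q) / (4 * q - 1) / 4 ^ n - (q - 1) * D := by
    have hs : ∑ k ∈ Finset.Ico 1 n, q ^ k * (2 * 4 ^ k / 4 ^ n) =
        2 / 4 ^ n * (((4 * q) ^ n - (4 * q) ^ 1) / (4 * q - 1)) := by
      rw [← geom_sum_Ico (by linarith) hn, Finset.mul_sum]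
      refine Finset.sum_congr rfl fun k _ => ?_
      rw [mul_pow]
      ring
    rw [hD]
    simp only [mul_sub, Finset.sum_sub_distrib]
    rw [hs, dyadicMean, mul_pow]
    generalize ∑ k ∈ Finset.Ico 1 n, q ^ k * ((sumInner n k : ℝ) / sumF n) = A
    have hq1' : q * 4 - 1 ≠ 0 := by linarith
    field_simp
    ring
  have hsmall : |(q - 1) * (8 * q) / (4 * q - 1) / 4 ^ n| ≤ q ^ n * (8 * q / 4 ^ n) := by
    rw [abs_of_nonneg (by positivity), ← mul_div_assoc]
    gcongr
    rw [div_le_iff₀ hq1]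
    have : 1 ≤ q ^ n := one_le_pow₀ hq.le
    calc (q - 1) * (8 * q) ≤ 8 * q * (4 * q - 1) := by nlinarith
      _ ≤ q ^ n * (8 * q) * (4 * q - 1) := by
        exact mul_le_mul_of_nonneg_right (le_mul_of_one_le_left (by positivity) this) hq1.le
  rw [hmain]
  calc _ ≤ _ := abs_sub _ _
    _ ≤ q ^ n * (8 * q / 4 ^ n) + q ^ n * (C / 4 ^ n) := add_le_add hsmall hDle
    _ = _ := by ring

end Displacement

/-- upper and lower bounds for the mean `ℓ` displacement. -/
theorem xi_bounds : ∀ ℓ : ℝ, 0 < ℓ → ∃ C : ℝ, 0 < C ∧ ∃ N : ℕ, ∀ n : ℕ, N ≤ n →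
    (2 : ℝ) ^ (((n : ℝ) - 1) * ℓ) *
        (((2 : ℝ) ^ (1 + ℓ) + 1) / ((2 : ℝ) ^ (2 + ℓ) - 1) -
          C * n * (4 : ℝ) ^ (-(n : ℝ))) ≤ xi n ℓ ∧
      xi n ℓ ≤
        (2 : ℝ) ^ ((n : ℝ) * ℓ) *
          (((2 : ℝ) ^ (1 + ℓ) + 1) / ((2 : ℝ) ^ (2 + ℓ) - 1) +
            C * n * (4 : ℝ) ^ (-(n : ℝ))) := by
  intro ℓ hℓ
  obtain ⟨C, hC, h⟩ := dyadicMean_asymptotics (Real.one_lt_rpow one_lt_two hℓ)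
  refine ⟨C, hC, 1, fun n hn => ?_⟩
  have hq : (0 : ℝ) < 2 ^ ℓ := by positivity
  have e1 : (2 : ℝ) ^ ((n : ℝ) * ℓ) = (2 ^ ℓ) ^ n := by
    rw [mul_comm, Real.rpow_mul (by norm_num), Real.rpow_natCast]
  have e2 : (2 : ℝ) ^ (((n : ℝ) - 1) * ℓ) = (2 ^ ℓ) ^ n / 2 ^ ℓ := by
    rw [sub_mul, one_mul, Real.rpow_sub (by norm_num), e1]
  have e3 : (2 : ℝ) ^ (1 + ℓ) = 2 * 2 ^ ℓ := by
    rw [Real.rpow_add (by norm_num), Real.rpow_one]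
  have e4 : (2 : ℝ) ^ (2 + ℓ) = 4 * 2 ^ ℓ := by
    rw [Real.rpow_add (by norm_num)]
    norm_num
  have e5 : (4 : ℝ) ^ (-(n : ℝ)) = 1 / 4 ^ n := by
    rw [Real.rpow_neg (by norm_num), Real.rpow_natCast, one_div]
  have hn' : C / 4 ^ n ≤ C * n * (1 / 4 ^ n) := by
    rw [mul_one_div]
    gcongr
    exact le_mul_of_one_le_right hC.le (by exact_mod_cast hn)
  rw [e1, e2, e3, e4, e5]
  obtain ⟨h1, h2⟩ := abs_le.1 (h n hn)
  obtain ⟨h3, h4⟩ := xi_dyadicMean hℓ hn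
  have h5 := mul_le_mul_of_nonneg_left hn' (by positivity : (0 : ℝ) ≤ (2 ^ ℓ) ^ n)
  constructor
  · rw [div_mul_eq_mul_div, div_le_iff₀ hq, mul_sub]
    linarith
  · rw [mul_add]
    linarith

end SierpinskiGasket
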